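/- arXiv:1501.00869 — 4 statements merged into one kernel-verified Lean document; each statement's English description precedes it below -/
import Mathlib

section
/- Let G be a critical graph and let xy be an edge of G with d_G(x) + d_G(y) = Δ(G) + 2, d_G(x) < Δ(G), and d_G(y) < Δ(G). Then every vertex of N(N(x) ∪ N(y)) \ {x, y} has degree Δ(G), where N(S) denotes the union of the neighborhoods of the vertices in S. -/
open SimpleGraph

variable {V : Type*}

/-- `c` is a proper edge coloring of `G` using colors `0, …, n-1`:
every edge gets a color `< n`, and distinct edges sharing an endpoint
receive distinct colors. -/
def IsProperEdgeColoring (G : SimpleGraph V) (n : ℕ) (c : Sym2 V → ℕ) : Prop :=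
  (∀ e ∈ G.edgeSet, c e < n) ∧
    ∀ e₁ ∈ G.edgeSet, ∀ e₂ ∈ G.edgeSet, e₁ ≠ e₂ → (∃ v, v ∈ e₁ ∧ v ∈ e₂) →
      c e₁ ≠ c e₂

/-- The edge chromatic number `χ'(G)`: the least number of colors in a proper
edge coloring of `G`. -/
noncomputable def edgeChromaticNumber (G : SimpleGraph V) : ℕ :=
  sInf {n | ∃ c, IsProperEdgeColoring G n c}

/-- The degree `d_G(v)` of a vertex. -/
noncomputable def deg (G : SimpleGraph V) (v : V) : ℕ := (G.neighborSet v).ncard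

/-- The maximum vertex degree `Δ(G)`. -/
noncomputable def maxDeg (G : SimpleGraph V) : ℕ := sSup {d | ∃ v, deg G v = d}

/-- `G` is critical: it is class 2 (i.e. `χ'(G) ≠ Δ(G)`) and every proper
subgraph `H` of `G` satisfies `χ'(H) < χ'(G)`. -/
def IsCritical (G : SimpleGraph V) : Prop :=
  edgeChromaticNumber G ≠ maxDeg G ∧
    ∀ H : G.Subgraph, H ≠ ⊤ → edgeChromaticNumber H.coe < edgeChromaticNumber G

/-- `G` is `k`-critical: critical with maximum degree `k`. -/
def IsKCritical (G : SimpleGraph V) (k : ℕ) : Prop :=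
  IsCritical G ∧ maxDeg G = k

section KempeChains

/-- The colors `< n` that do not appear on the edges at `v`. -/
def missingColors (G : SimpleGraph V) (n : ℕ) (c : Sym2 V → ℕ) (v : V) : Set ℕ :=
  {k | k < n ∧ ∀ w, G.Adj v w → c s(v, w) ≠ k}

/-- The subgraph of the edges colored `a` or `b`. -/
def kempeGraph (G : SimpleGraph V) (c : Sym2 V → ℕ) (a b : ℕ) : SimpleGraph V where
  Adj u v := G.Adj u v ∧ (c s(u, v) = a ∨ c s(u, v) = b)
  symm := ⟨fun u v h ↦ by rw [Sym2.eq_swap]; exact ⟨h.1.symm, h.2⟩⟩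
  loopless := ⟨fun _ h ↦ h.1.ne rfl⟩

open scoped Classical in
/-- The coloring obtained by exchanging `a` and `b` on the Kempe chain through `u`. -/
noncomputable def kempeSwap (G : SimpleGraph V) (c : Sym2 V → ℕ) (a b : ℕ) (u : V)
    (e : Sym2 V) : ℕ :=
  if ∃ v ∈ e, (kempeGraph G c a b).Reachable u v then Equiv.swap a b (c e) else c e

variable {G : SimpleGraph V} {n : ℕ} {c : Sym2 V → ℕ} {a b : ℕ}

lemma IsProperEdgeColoring.ne (hc : IsProperEdgeColoring G n c) {u v w : V}
    (hv : G.Adj u v) (hw : G.Adj u w) (h : v ≠ w) : c s(u, v) ≠ c s(u, w) :=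
  hc.2 _ hv _ hw (fun h' ↦ h (Sym2.congr_right.1 h')) ⟨u, by simp, by simp⟩

lemma isProperEdgeColoring_of_adj (hlt : ∀ u v, G.Adj u v → c s(u, v) < n)
    (hne : ∀ u v w, G.Adj u v → G.Adj u w → v ≠ w → c s(u, v) ≠ c s(u, w)) :
    IsProperEdgeColoring G n c := by
  refine ⟨fun e he ↦ ?_, ?_⟩
  · induction e with | _ u v => exact hlt u v he
  · rintro e₁ h₁ e₂ h₂ hne' ⟨v, hv₁, hv₂⟩
    obtain ⟨w₁, rfl⟩ := hv₁
    obtain ⟨w₂, rfl⟩ := hv₂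
    exact hne v w₁ w₂ h₁ h₂ (by rintro rfl; exact hne' rfl)

lemma kempeSwap_of_reachable {u v : V} (h : (kempeGraph G c a b).Reachable u v) (w : V) :
    kempeSwap G c a b u s(v, w) = Equiv.swap a b (c s(v, w)) :=
  if_pos ⟨v, by simp, h⟩

lemma kempeSwap_of_not_reachable {u v w : V} (h : ¬ (kempeGraph G c a b).Reachable u v)
    (hvw : G.Adj v w) : kempeSwap G c a b u s(v, w) = c s(v, w) := by
  unfold kempeSwap
  split_ifs with h'
  · by_cases hab : c s(v, w) = a ∨ c s(v, w) = b
    · obtain ⟨t, ht, hut⟩ := h'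
      have hadj : (kempeGraph G c a b).Adj v w := ⟨hvw, hab⟩
      rcases Sym2.mem_iff.1 ht with rfl | rfl
      · exact (h hut).elim
      · exact (h (hut.trans hadj.symm.reachable)).elim
    · push Not at hab
      exact Equiv.swap_apply_of_ne_of_ne hab.1 hab.2
  · rfl

lemma IsProperEdgeColoring.kempeSwap (hc : IsProperEdgeColoring G n c) (ha : a < n) (hb : b < n)
    (u : V) : IsProperEdgeColoring G n (kempeSwap G c a b u) := by
  refine isProperEdgeColoring_of_adj (fun v w hvw ↦ ?_) (fun v w₁ w₂ h₁ h₂ hne ↦ ?_)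
  · by_cases h : (kempeGraph G c a b).Reachable u v
    · rw [kempeSwap_of_reachable h, Equiv.swap_apply_def]
      have := hc.1 s(v, w) hvw
      split_ifs <;> assumption
    · rw [kempeSwap_of_not_reachable h hvw]
      exact hc.1 _ hvw
  · by_cases h : (kempeGraph G c a b).Reachable u v
    · rw [kempeSwap_of_reachable h, kempeSwap_of_reachable h]
      exact (Equiv.swap a b).injective.ne (hc.ne h₁ h₂ hne)
    · rw [kempeSwap_of_not_reachable h h₁, kempeSwap_of_not_reachable h h₂]
      exact hc.ne h₁ h₂ hne

lemma missingColors_congr {c' : Sym2 V → ℕ} {v : V}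
    (h : ∀ w, G.Adj v w → c' s(v, w) = c s(v, w)) :
    missingColors G n c' v = missingColors G n c v := by
  ext k
  simp only [missingColors, Set.mem_ofPred_eq]
  grind

lemma swap_mem_missingColors {c' : Sym2 V → ℕ} {v : V} {k : ℕ} (ha : a < n) (hb : b < n)
    (h : ∀ w, G.Adj v w → c' s(v, w) = Equiv.swap a b (c s(v, w)))
    (hk : k ∈ missingColors G n c v) : Equiv.swap a b k ∈ missingColors G n c' v := by
  refine ⟨?_, fun w hw ↦ ?_⟩
  · rw [Equiv.swap_apply_def]
    have := hk.1
    split_ifs <;> assumption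
  · rw [h w hw]
    exact (Equiv.swap a b).injective.ne (hk.2 w hw)

/-- A connected graph of maximum degree at most two has at most two vertices of degree at most
one. -/
lemma SimpleGraph.Connected.not_three_endpoints {W : Type*} [Fintype W] {K : SimpleGraph W}
    (hK : K.Connected) (h2 : ∀ v, (K.neighborSet v).ncard ≤ 2) {s : Finset W} (hs : s.card = 3)
    (h1 : ∀ v ∈ s, (K.neighborSet v).ncard ≤ 1) : False := by
  classical
  have hdeg (v : W) : K.degree v = (K.neighborSet v).ncard := by
    rw [← K.card_neighborSet_eq_degree, Set.ncard_eq_toFinset_card', Set.toFinset_card]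
  have hsum : ∑ v, (K.degree v + if v ∈ s then 1 else 0) ≤ ∑ _v : W, 2 := by
    refine Finset.sum_le_sum fun v _ ↦ ?_
    split_ifs with h
    · have := h1 v h
      rw [hdeg]; omega
    · rw [hdeg]; exact h2 v
  have hE := hK.card_vert_le_card_edgeSet_add_one
  rw [Nat.card_eq_fintype_card, Nat.card_eq_fintype_card, ← K.edgeFinset_card] at hE
  rw [Finset.sum_add_distrib, K.sum_degrees_eq_twice_card_edges] at hsum
  simp [hs] at hsum
  omega

lemma ncard_neighborSet_kempeGraph_le (hc : IsProperEdgeColoring G n c) {v : V} {s : Finset ℕ}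
    (hs : ∀ w, (kempeGraph G c a b).Adj v w → c s(v, w) ∈ s) :
    ((kempeGraph G c a b).neighborSet v).ncard ≤ s.card := by
  rw [← Set.ncard_coe_finset]
  refine Set.ncard_le_ncard_of_injOn (fun w ↦ c s(v, w)) hs (fun w₁ h₁ w₂ h₂ h ↦ ?_)
    s.finite_toSet
  by_contra hne
  exact hc.ne h₁.1 h₂.1 hne h

/-- A Kempe chain contains at most two vertices at which one of its colors is missing. -/
lemma not_reachable_of_missing [Finite V] (hc : IsProperEdgeColoring G n c) {x y u : V}
    (hxy : x ≠ y) (hux : u ≠ x) (huy : u ≠ y)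
    (hx : a ∈ missingColors G n c x ∨ b ∈ missingColors G n c x)
    (hy : a ∈ missingColors G n c y ∨ b ∈ missingColors G n c y)
    (hu : a ∈ missingColors G n c u ∨ b ∈ missingColors G n c u)
    (h : (kempeGraph G c a b).Reachable x y) : ¬ (kempeGraph G c a b).Reachable x u := by
  classical
  intro h'
  have := Fintype.ofFinite V
  set K := kempeGraph G c a b
  have h2 (v : V) : (K.neighborSet v).ncard ≤ 2 :=
    (ncard_neighborSet_kempeGraph_le hc (s := {a, b}) (fun w hw ↦ by simpa using hw.2)).trans
      Finset.card_le_two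
  have h1 (v : V) (hv : a ∈ missingColors G n c v ∨ b ∈ missingColors G n c v) :
      (K.neighborSet v).ncard ≤ 1 := by
    rcases hv with hv | hv
    · exact ncard_neighborSet_kempeGraph_le hc (s := {b}) fun w hw ↦ by
        simpa [hv.2 w hw.1] using hw.2
    · exact ncard_neighborSet_kempeGraph_le hc (s := {a}) fun w hw ↦ by
        simpa [hv.2 w hw.1] using hw.2
  let C := K.connectedComponentMk x
  have hC (v : C.supp) :
      (C.toSimpleGraph.neighborSet v).ncard ≤ (K.neighborSet v).ncard :=
    Set.ncard_le_ncard_of_injOn (fun w ↦ (w : V)) (fun w hw ↦ hw)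
      (Subtype.val_injective.injOn) (Set.toFinite _)
  have memC {v : V} (hv : K.Reachable x v) : v ∈ C.supp :=
    SimpleGraph.ConnectedComponent.sound hv.symm
  refine C.connected_toSimpleGraph.not_three_endpoints (fun v ↦ (hC v).trans (h2 v))
    (s := {⟨x, memC .rfl⟩, ⟨y, memC h⟩, ⟨u, memC h'⟩}) ?_ ?_
  · rw [Finset.card_eq_three]
    exact ⟨_, _, _, by simpa using hxy, by simpa using hux.symm, by simpa using huy.symm, rfl⟩
  · intro v hv
    refine (hC v).trans (h1 v ?_)
    simp only [Finset.mem_insert, Finset.mem_singleton] at hv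
    rcases hv with rfl | rfl | rfl <;> assumption

variable {x y : V}

lemma reachable_of_missing
    (hdis : ∀ c, IsProperEdgeColoring G n c →
      Disjoint (missingColors G n c x) (missingColors G n c y))
    (hc : IsProperEdgeColoring G n c) (ha : a ∈ missingColors G n c x)
    (hb : b ∈ missingColors G n c y) : (kempeGraph G c a b).Reachable x y := by
  by_contra h
  refine Set.disjoint_left.1 (hdis _ (hc.kempeSwap ha.1 hb.1 x)) (?_ : b ∈ _) ?_
  · simpa using swap_mem_missingColors ha.1 hb.1
      (fun w _ ↦ kempeSwap_of_reachable (.refl x) w) ha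
  · rwa [missingColors_congr fun w hw ↦ kempeSwap_of_not_reachable h hw]

/-- A missing color of a third vertex can be exchanged without disturbing the edges at `x` and
`y`. -/
lemma exists_kempeSwap [Finite V] (hxy : x ≠ y)
    (hdis : ∀ c, IsProperEdgeColoring G n c →
      Disjoint (missingColors G n c x) (missingColors G n c y))
    (hc : IsProperEdgeColoring G n c) (ha : a ∈ missingColors G n c x)
    (hb : b ∈ missingColors G n c y) {u : V} (hux : u ≠ x) (huy : u ≠ y)
    (hu : a ∈ missingColors G n c u ∨ b ∈ missingColors G n c u) :
    ∃ c', IsProperEdgeColoring G n c' ∧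
      (∀ w, G.Adj x w → c' s(x, w) = c s(x, w)) ∧ (∀ w, G.Adj y w → c' s(y, w) = c s(y, w)) ∧
      ∀ w, c' s(u, w) = Equiv.swap a b (c s(u, w)) := by
  have hreach := reachable_of_missing hdis hc ha hb
  have hnot := not_reachable_of_missing hc hxy hux huy (.inl ha) (.inr hb) hu hreach
  exact ⟨kempeSwap G c a b u, hc.kempeSwap ha.1 hb.1 u,
    fun w ↦ kempeSwap_of_not_reachable fun h ↦ hnot h.symm,
    fun w ↦ kempeSwap_of_not_reachable fun h ↦ hnot (hreach.trans h.symm),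
    kempeSwap_of_reachable (.refl u)⟩

lemma not_mem_missingColors_neighbor
    (hdis : ∀ c, IsProperEdgeColoring G n c →
      Disjoint (missingColors G n c x) (missingColors G n c y))
    (hc : IsProperEdgeColoring G n c) {z : V} (hxz : G.Adj x z) (hxy : x ≠ y) (hzy : z ≠ y)
    (hb : c s(x, z) ∈ missingColors G n c y) (ha : a ∈ missingColors G n c x) :
    a ∉ missingColors G n c z := by
  classical
  intro haz
  have hupd {v w : V} (h : s(v, w) ≠ s(x, z)) : Function.update c s(x, z) a s(v, w) = c s(v, w) :=
    Function.update_of_ne h _ _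
  have hmiss : ∀ v w, G.Adj v w → (v = x ∨ v = z) → c s(v, w) ≠ a := by
    rintro v w hvw (rfl | rfl)
    exacts [ha.2 w hvw, haz.2 w hvw]
  have hc' : IsProperEdgeColoring G n (Function.update c s(x, z) a) := by
    refine isProperEdgeColoring_of_adj (fun v w hvw ↦ ?_) (fun v w₁ w₂ h₁ h₂ hne ↦ ?_)
    · rw [Function.update_apply]
      split_ifs
      exacts [ha.1, hc.1 _ hvw]
    · have := hc.ne h₁ h₂ hne
      have := hmiss v w₁ h₁
      have := hmiss v w₂ h₂
      simp only [Function.update_apply, Sym2.eq_iff]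
      grind
  refine Set.disjoint_left.1 (hdis _ hc')
    (show c s(x, z) ∈ missingColors G n _ x from ⟨hb.1, fun w hw ↦ ?_⟩) ?_
  · by_cases hwz : w = z
    · subst hwz
      simpa using (ha.2 w hw).symm
    · rw [hupd fun h ↦ hwz (Sym2.congr_right.1 h)]
      exact hc.ne hw hxz hwz
  · rwa [missingColors_congr fun w _ ↦ hupd (by simp; grind)]

lemma missingColors_neighbor_not_nonempty [Finite V]
    (hdis : ∀ c, IsProperEdgeColoring G n c →
      Disjoint (missingColors G n c x) (missingColors G n c y))
    (hc : IsProperEdgeColoring G n c)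
    (htotal : ∀ k < n, k ∈ missingColors G n c x ∨ k ∈ missingColors G n c y)
    {z : V} (hxz : G.Adj x z) (hzy : z ≠ y) (hx : (missingColors G n c x).Nonempty) :
    ¬ (missingColors G n c z).Nonempty := by
  rintro ⟨k, hk⟩
  obtain ⟨a, ha⟩ := hx
  have hxy : x ≠ y := by
    rintro rfl
    exact Set.disjoint_left.1 (hdis c hc) ha ha
  have hb : c s(x, z) ∈ missingColors G n c y :=
    (htotal _ (hc.1 _ hxz)).resolve_left fun h ↦ h.2 z hxz rfl
  rcases htotal k hk.1 with hkx | hky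
  · exact not_mem_missingColors_neighbor hdis hc hxz hxy hzy hb hkx hk
  obtain ⟨c', hc', hx', hy', hz'⟩ :=
    exists_kempeSwap hxy hdis hc ha hky hxz.ne' hzy (.inr hk)
  refine not_mem_missingColors_neighbor hdis hc' hxz hxy hzy ?_ (a := a) ?_ ?_
  · rwa [missingColors_congr hy', hx' z hxz]
  · rwa [missingColors_congr hx']
  · simpa using swap_mem_missingColors ha.1 hky.1 (fun w _ ↦ hz' w) hk

lemma missingColors_second_neighbor_not_nonempty_of_mem [Finite V]
    (hdis : ∀ c, IsProperEdgeColoring G n c →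
      Disjoint (missingColors G n c x) (missingColors G n c y))
    (hc : IsProperEdgeColoring G n c)
    (htotal : ∀ k < n, k ∈ missingColors G n c x ∨ k ∈ missingColors G n c y)
    {z u : V} (hxz : G.Adj x z) (hzu : G.Adj z u) (hux : u ≠ x) (huy : u ≠ y)
    (hx : ∀ k, ∃ a ∈ missingColors G n c x, a ≠ k) (hγ : c s(u, z) ∈ missingColors G n c x) :
    ¬ (missingColors G n c u).Nonempty := by
  rintro ⟨k, hk⟩
  have hxy : x ≠ y := by
    rintro rfl
    exact Set.disjoint_left.1 (hdis c hc) hγ hγ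
  have hb : c s(x, z) ∈ missingColors G n c y :=
    (htotal _ (hc.1 _ hxz)).resolve_left fun h ↦ h.2 z hxz rfl
  have key : ∀ c', IsProperEdgeColoring G n c' →
      c' s(u, z) ∈ missingColors G n c' x → c' s(x, z) ∈ missingColors G n c' y →
      c' s(x, z) ∉ missingColors G n c' u := by
    intro c' hc' hγ' hb' hu'
    have hreach := reachable_of_missing hdis hc' hγ' hb'
    refine not_reachable_of_missing hc' hxy hux huy (.inl hγ') (.inr hb') (.inr hu') hreach ?_
    have h₁ : (kempeGraph G c' (c' s(u, z)) (c' s(x, z))).Adj x z := ⟨hxz, .inr rfl⟩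
    have h₂ : (kempeGraph G c' (c' s(u, z)) (c' s(x, z))).Adj u z := ⟨hzu.symm, .inl rfl⟩
    exact h₁.reachable.trans h₂.symm.reachable
  have hγb : c s(u, z) ≠ c s(x, z) := fun h ↦ Set.disjoint_left.1 (hdis c hc) hγ (h ▸ hb)
  have step : ∀ c', IsProperEdgeColoring G n c' →
      (∀ w, G.Adj x w → c' s(x, w) = c s(x, w)) → (∀ w, G.Adj y w → c' s(y, w) = c s(y, w)) →
      c' s(u, z) = c s(u, z) → ∀ a ∈ missingColors G n c x, a ∉ missingColors G n c' u := by
    intro c' hc' hx' hy' hu' a ha hau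
    have ha' := ha
    have hb' := hb
    rw [← missingColors_congr hx'] at ha'
    rw [← missingColors_congr hy'] at hb'
    obtain ⟨c'', hc'', hx'', hy'', hu''⟩ :=
      exists_kempeSwap hxy hdis hc' ha' hb' hux huy (.inl hau)
    have h₁ : c'' s(u, z) = c s(u, z) := by
      rw [hu'', Equiv.swap_apply_of_ne_of_ne, hu']
      · exact hau.2 z hzu.symm
      · rwa [hu']
    have h₂ : c'' s(x, z) = c s(x, z) := by rw [hx'' z hxz, hx' z hxz]
    refine key c'' hc'' ?_ ?_ ?_
    · rwa [h₁, missingColors_congr hx'', missingColors_congr hx']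
    · rwa [h₂, missingColors_congr hy'']
    · rw [h₂]
      simpa using swap_mem_missingColors ha.1 hb.1 (fun w _ ↦ hu'' w) hau
  rcases htotal k hk.1 with hkx | hky
  · exact step c hc (fun _ _ ↦ rfl) (fun _ _ ↦ rfl) rfl k hkx hk
  · obtain ⟨a, ha, haγ⟩ := hx (c s(u, z))
    obtain ⟨c', hc', hx', hy', hu'⟩ :=
      exists_kempeSwap hxy hdis hc ha hky hux huy (.inr hk)
    refine step c' hc' hx' hy' ?_ a ha ?_
    · rw [hu', Equiv.swap_apply_of_ne_of_ne haγ.symm (hk.2 z hzu.symm)]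
    · simpa using swap_mem_missingColors ha.1 hky.1 (fun w _ ↦ hu' w) hk

lemma missingColors_second_neighbor_not_nonempty [Finite V]
    (hdis : ∀ c, IsProperEdgeColoring G n c →
      Disjoint (missingColors G n c x) (missingColors G n c y))
    (hc : IsProperEdgeColoring G n c)
    (htotal : ∀ k < n, k ∈ missingColors G n c x ∨ k ∈ missingColors G n c y)
    {z u : V} (hxz : G.Adj x z) (hzu : G.Adj z u) (hux : u ≠ x) (huy : u ≠ y)
    (hx : ∀ k, ∃ a ∈ missingColors G n c x, a ≠ k) :
    ¬ (missingColors G n c u).Nonempty := by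
  rintro ⟨k, hk⟩
  rcases htotal _ (hc.1 s(u, z) hzu.symm) with hγ | hγ
  · exact missingColors_second_neighbor_not_nonempty_of_mem hdis hc htotal hxz hzu hux huy hx hγ
      ⟨k, hk⟩
  have hxy : x ≠ y := by
    obtain ⟨a, ha, -⟩ := hx 0
    rintro rfl
    exact Set.disjoint_left.1 (hdis c hc) ha ha
  have step : ∀ c', IsProperEdgeColoring G n c' →
      (∀ w, G.Adj x w → c' s(x, w) = c s(x, w)) → (∀ w, G.Adj y w → c' s(y, w) = c s(y, w)) →
      c' s(u, z) = c s(u, z) → ∀ a ∈ missingColors G n c x, a ∉ missingColors G n c' u := by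
    intro c' hc' hx' hy' hu' a ha hau
    have ha' := ha
    have hγ' := hγ
    rw [← missingColors_congr hx'] at ha'
    rw [← missingColors_congr hy'] at hγ'
    obtain ⟨c'', hc'', hx'', hy'', hu''⟩ :=
      exists_kempeSwap hxy hdis hc' ha' hγ' hux huy (.inl hau)
    have hxx : missingColors G n c'' x = missingColors G n c x := by
      rw [missingColors_congr hx'', missingColors_congr hx']
    have hyy : missingColors G n c'' y = missingColors G n c y := by
      rw [missingColors_congr hy'', missingColors_congr hy']
    refine missingColors_second_neighbor_not_nonempty_of_mem hdis hc'' ?_ hxz hzu hux huy ?_ ?_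
      ⟨_, swap_mem_missingColors ha.1 hγ.1 (fun w _ ↦ hu'' w) hau⟩
    · rwa [hxx, hyy]
    · rwa [hxx]
    · rwa [hxx, hu'', hu', Equiv.swap_apply_right]
  rcases htotal k hk.1 with hkx | hky
  · exact step c hc (fun _ _ ↦ rfl) (fun _ _ ↦ rfl) rfl k hkx hk
  · obtain ⟨a, ha, haγ⟩ := hx (c s(u, z))
    obtain ⟨c', hc', hx', hy', hu'⟩ :=
      exists_kempeSwap hxy hdis hc ha hky hux huy (.inr hk)
    refine step c' hc' hx' hy' ?_ a ha ?_
    · rw [hu', Equiv.swap_apply_of_ne_of_ne haγ.symm (hk.2 z hzu.symm)]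
    · simpa using swap_mem_missingColors ha.1 hky.1 (fun w _ ↦ hu' w) hk

end KempeChains

lemma deg_deleteEdges {G : SimpleGraph V} {x y : V} (h : G.Adj x y) :
    deg (G.deleteEdges {s(x, y)}) x = deg G x - 1 := by
  have : (G.deleteEdges {s(x, y)}).neighborSet x = G.neighborSet x \ {y} := by
    ext w
    simp only [SimpleGraph.mem_neighborSet, SimpleGraph.deleteEdges_adj, Set.mem_singleton_iff,
      Set.mem_sdiff, Sym2.eq_iff]
    grind
  rw [deg, this, Set.ncard_sdiff_singleton_of_mem (by exact h), deg]

section Counting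

variable [Finite V] {G : SimpleGraph V} {n : ℕ} {c : Sym2 V → ℕ}

/-- The colors that appear on the edges at `v`. -/
noncomputable def presentColors (G : SimpleGraph V) (c : Sym2 V → ℕ) (v : V) : Finset ℕ :=
  (((fun w ↦ c s(v, w)) '' G.neighborSet v).toFinite).toFinset

lemma mem_missingColors_iff {v : V} {k : ℕ} :
    k ∈ missingColors G n c v ↔ k < n ∧ k ∉ presentColors G c v := by
  simp [missingColors, presentColors]

lemma card_presentColors (hc : IsProperEdgeColoring G n c) (v : V) :
    (presentColors G c v).card = deg G v := by
  rw [presentColors, ← Set.ncard_eq_toFinset_card _ (Set.toFinite _), deg]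
  refine Set.InjOn.ncard_image fun w₁ h₁ w₂ h₂ h ↦ ?_
  by_contra hne
  exact hc.ne h₁ h₂ hne h

lemma exists_mem_missingColors_ne {v : V} (h : (presentColors G c v).card + 2 ≤ n) (k : ℕ) :
    ∃ a ∈ missingColors G n c v, a ≠ k := by
  obtain ⟨a, ha, ha'⟩ := Finset.exists_mem_notMem_of_card_lt_card
    (s := insert k (presentColors G c v)) (t := Finset.range n) (by
      have := Finset.card_insert_le k (presentColors G c v)
      rw [Finset.card_range]
      omega)
  rw [Finset.mem_insert, not_or] at ha'
  exact ⟨a, mem_missingColors_iff.2 ⟨Finset.mem_range.1 ha, ha'.2⟩, ha'.1⟩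

lemma deg_pos {x y : V} (h : G.Adj x y) : 0 < deg G x :=
  (Set.ncard_pos).2 ⟨y, h⟩

lemma deg_mono {H : SimpleGraph V} (h : H ≤ G) (v : V) : deg H v ≤ deg G v :=
  Set.ncard_le_ncard (fun _ hw ↦ h hw)

lemma maxDeg_le (hc : IsProperEdgeColoring G n c) : maxDeg G ≤ n := by
  rcases isEmpty_or_nonempty V with hV | ⟨⟨v⟩⟩
  · simp [maxDeg]
  refine csSup_le ⟨_, v, rfl⟩ ?_
  rintro _ ⟨v, rfl⟩
  rw [← card_presentColors hc v]
  simpa using Finset.card_le_card (t := Finset.range n) (s := presentColors G c v) fun k hk ↦ by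
    simp only [presentColors, Set.Finite.mem_toFinset, Set.mem_image,
      SimpleGraph.mem_neighborSet] at hk
    obtain ⟨w, hw, rfl⟩ := hk
    exact Finset.mem_range.2 (hc.1 _ hw)

end Counting

lemma IsProperEdgeColoring.of_hom {W : Type*} {G : SimpleGraph V} {H : SimpleGraph W} {n : ℕ}
    {c : Sym2 V → ℕ} (hc : IsProperEdgeColoring G n c) (f : H →g G)
    (hf : Function.Injective f) : IsProperEdgeColoring H n (fun e ↦ c (e.map f)) :=
  isProperEdgeColoring_of_adj (fun _ _ h ↦ hc.1 _ (f.map_adj h))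
    fun _ _ _ h₁ h₂ hne ↦ hc.ne (f.map_adj h₁) (f.map_adj h₂) (hf.ne hne)

/-- A proper coloring of `G - xy` extends to `G` when the ends of `xy` miss a common color. -/
lemma exists_coloring_of_not_disjoint {G : SimpleGraph V} {x y : V} {n : ℕ} {c : Sym2 V → ℕ}
    (hc : IsProperEdgeColoring (G.deleteEdges {s(x, y)}) n c)
    (h : ¬ Disjoint (missingColors (G.deleteEdges {s(x, y)}) n c x)
      (missingColors (G.deleteEdges {s(x, y)}) n c y)) :
    ∃ c', IsProperEdgeColoring G n c' := by
  classical
  obtain ⟨k, hkx, hky⟩ := Set.not_disjoint_iff.1 h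
  have hadj {v w : V} (h : G.Adj v w) (h' : s(v, w) ≠ s(x, y)) :
      (G.deleteEdges {s(x, y)}).Adj v w := by
    simpa [SimpleGraph.deleteEdges_adj, h] using h'
  have hmiss : ∀ v w, G.Adj v w → s(v, w) ≠ s(x, y) → (v = x ∨ v = y) → c s(v, w) ≠ k := by
    rintro v w hvw hne (rfl | rfl)
    exacts [hkx.2 w (hadj hvw hne), hky.2 w (hadj hvw hne)]
  refine ⟨Function.update c s(x, y) k,
    isProperEdgeColoring_of_adj (fun v w hvw ↦ ?_) (fun v w₁ w₂ h₁ h₂ hne ↦ ?_)⟩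
  · rw [Function.update_apply]
    split_ifs with h
    exacts [hkx.1, hc.1 _ (hadj hvw h)]
  · have := fun h h' ↦ hc.ne (hadj h₁ h) (hadj h₂ h') hne
    have := hmiss v w₁ h₁
    have := hmiss v w₂ h₂
    simp only [Function.update_apply, ne_eq, Sym2.eq_iff] at *
    grind

lemma exists_coloring_deleteEdges_of_isCritical [Finite V] {G : SimpleGraph V}
    (hG : IsCritical G) {x y : V} (hxy : G.Adj x y) :
    ∃ n c, IsProperEdgeColoring (G.deleteEdges {s(x, y)}) n c ∧
      (∀ c, IsProperEdgeColoring (G.deleteEdges {s(x, y)}) n c →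
        Disjoint (missingColors (G.deleteEdges {s(x, y)}) n c x)
          (missingColors (G.deleteEdges {s(x, y)}) n c y)) ∧
      maxDeg G ≤ n := by
  set H := SimpleGraph.toSubgraph _ (G.deleteEdges_le {s(x, y)}) with hH
  have hlt : edgeChromaticNumber H.coe < edgeChromaticNumber G := by
    refine hG.2 H fun h ↦ ?_
    have : H.Adj x y := by rw [h]; exact hxy
    simp [hH] at this
  have hne : {n | ∃ c, IsProperEdgeColoring G n c}.Nonempty :=
    Nat.nonempty_of_pos_sInf (Nat.zero_lt_of_lt hlt)
  obtain ⟨c, hc⟩ : ∃ c, IsProperEdgeColoring G (edgeChromaticNumber G) c := Nat.sInf_mem hne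
  obtain ⟨d, hd⟩ : ∃ d, IsProperEdgeColoring H.coe (edgeChromaticNumber H.coe) d :=
    Nat.sInf_mem (s := {n | ∃ c, IsProperEdgeColoring H.coe n c})
      ⟨_, _, hc.of_hom H.hom H.hom_injective⟩
  let f : G.deleteEdges {s(x, y)} →g H.coe :=
    ⟨fun v ↦ ⟨v, trivial⟩, fun h ↦ h⟩
  have hd' := hd.of_hom f fun _ _ h ↦ congrArg Subtype.val h
  have hmax : maxDeg G < edgeChromaticNumber G := (maxDeg_le hc).lt_of_ne hG.1.symm
  refine ⟨edgeChromaticNumber G - 1, _, ⟨fun e he ↦ (hd'.1 e he).trans_le (by omega), hd'.2⟩,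
    fun c' hc' ↦ ?_, by omega⟩
  by_contra h
  have : edgeChromaticNumber G ≤ edgeChromaticNumber G - 1 :=
    Nat.sInf_le (exists_coloring_of_not_disjoint hc' h)
  omega

/-- If `G` is critical and `xy ∈ E(G)` with `d_G(x) + d_G(y) = Δ(G) + 2`,
`d_G(x) < Δ(G)` and `d_G(y) < Δ(G)`, then every vertex of
`N(N(x) ∪ N(y)) \ {x, y}` has degree `Δ(G)`. -/
theorem critical_second_neighbors_maxDegree [Fintype V] (G : SimpleGraph V)
    (hG : IsCritical G) {x y : V} (hxy : G.Adj x y)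
    (hdeg : deg G x + deg G y = maxDeg G + 2)
    (hx : deg G x < maxDeg G) (hy : deg G y < maxDeg G) :
    ∀ u ∈ (⋃ w ∈ G.neighborSet x ∪ G.neighborSet y, G.neighborSet w) \ {x, y},
      deg G u = maxDeg G := by
  classical
  have hfin : {d | ∃ v, deg G v = d}.Finite := Set.finite_range (deg G)
  have hle (v : V) : deg G v ≤ maxDeg G := le_csSup hfin.bddAbove ⟨v, rfl⟩
  obtain ⟨n, c, hc, hdis, hn⟩ := exists_coloring_deleteEdges_of_isCritical hG hxy
  set H := G.deleteEdges {s(x, y)} with hH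
  have hHx : ((presentColors H c x).card) = deg G x - 1 := by
    rw [card_presentColors hc, deg_deleteEdges hxy]
  have hHy : ((presentColors H c y).card) = deg G y - 1 := by
    rw [card_presentColors hc, hH, Sym2.eq_swap, deg_deleteEdges hxy.symm]
  have hcover : Finset.range n ⊆ presentColors H c x ∪ presentColors H c y := by
    intro k hk
    by_contra hk'
    rw [Finset.mem_union, not_or] at hk'
    have hk := Finset.mem_range.1 hk
    exact Set.disjoint_left.1 (hdis c hc) (mem_missingColors_iff.2 ⟨hk, hk'.1⟩)
      (mem_missingColors_iff.2 ⟨hk, hk'.2⟩)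
  have hcard := Finset.card_le_card hcover
  have hunion := Finset.card_union_add_card_inter (presentColors H c x) (presentColors H c y)
  rw [Finset.card_range] at hcard
  have hxpos : 0 < deg G x := deg_pos hxy
  have hypos : 0 < deg G y := deg_pos hxy.symm
  have hinter : presentColors H c x ∩ presentColors H c y = ∅ := by
    rw [← Finset.card_eq_zero]
    omega
  have htotal : ∀ k < n, k ∈ missingColors H n c x ∨ k ∈ missingColors H n c y := by
    intro k hk
    by_contra! h
    have : k ∈ presentColors H c x ∩ presentColors H c y := by
      simp only [mem_missingColors_iff, hk, true_and, not_not] at h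
      exact Finset.mem_inter.2 h
    simp [hinter] at this
  have hmx : ∀ k, ∃ a ∈ missingColors H n c x, a ≠ k :=
    exists_mem_missingColors_ne (by omega)
  have hmy : ∀ k, ∃ a ∈ missingColors H n c y, a ≠ k :=
    exists_mem_missingColors_ne (by omega)
  rintro u ⟨hu, hu'⟩
  simp only [Set.mem_insert_iff, Set.mem_singleton_iff, not_or] at hu'
  obtain ⟨hux, huy⟩ := hu'
  by_contra hne
  have hlt : deg G u < n := by have := hle u; omega
  have hmu : (missingColors H n c u).Nonempty := by
    obtain ⟨k, hk, hk'⟩ := Finset.exists_mem_notMem_of_card_lt_card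
      (s := presentColors H c u) (t := Finset.range n) (by
        rw [card_presentColors hc, Finset.card_range]
        exact (deg_mono (G.deleteEdges_le _) u).trans_lt hlt)
    exact ⟨k, mem_missingColors_iff.2 ⟨Finset.mem_range.1 hk, hk'⟩⟩
  have hadj {v w : V} (h : G.Adj v w) (h' : s(v, w) ≠ s(x, y)) : H.Adj v w := by
    simpa [hH, SimpleGraph.deleteEdges_adj, h] using h'
  have hdis' : ∀ c, IsProperEdgeColoring H n c →
      Disjoint (missingColors H n c y) (missingColors H n c x) := fun c hc ↦ (hdis c hc).symm
  have htotal' := fun k hk ↦ (htotal k hk).symm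
  simp only [Set.mem_iUnion, SimpleGraph.mem_neighborSet, Set.mem_union, exists_prop] at hu
  obtain ⟨w, hw, hwu⟩ := hu
  by_cases hwx : w = x
  · subst hwx
    exact missingColors_neighbor_not_nonempty hdis hc htotal (hadj hwu (by simp; grind))
      huy ((hmx 0).imp fun _ ↦ And.left) hmu
  by_cases hwy : w = y
  · subst hwy
    exact missingColors_neighbor_not_nonempty hdis' hc htotal' (hadj hwu (by simp; grind))
      hux ((hmy 0).imp fun _ ↦ And.left) hmu
  have hwu' : H.Adj w u := hadj hwu (by simp; grind)
  rcases hw with hw | hw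
  · exact missingColors_second_neighbor_not_nonempty hdis hc htotal
      (hadj hw (by simp; grind)) hwu' hux huy hmx hmu
  · exact missingColors_second_neighbor_not_nonempty hdis' hc htotal'
      (hadj hw (by simp; grind)) hwu' huy hux hmy hmu
end

section
/- If G is a 4-critical graph, then |E(G)| ≥ (12/7)·|V(G)|. -/
open SimpleGraph

variable {V : Type*}

namespace EdgeColoring

/-- `c u v` is the color of the edge `uv`; non-edges of `H` have a value `≥ m`. -/
structure IsColoring (H : SimpleGraph V) (m : ℕ) (c : V → V → ℕ) : Prop where
  symm : ∀ u v, c u v = c v u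
  lt_iff : ∀ u v, c u v < m ↔ H.Adj u v
  inj : ∀ u v w, c u v = c u w → c u v < m → v = w

/-- The color `α` does not appear at the vertex `v`. -/
def Misses (c : V → V → ℕ) (v : V) (α : ℕ) : Prop := ∀ w, c v w ≠ α

open Classical in
/-- Give the edge `xy` the color `α`. -/
noncomputable def recolor (c : V → V → ℕ) (x y : V) (α : ℕ) : V → V → ℕ :=
  fun u v => if (u = x ∧ v = y) ∨ (u = y ∧ v = x) then α else c u v

lemma deleteEdges_adj' {G : SimpleGraph V} {x y u v : V} :
    (G.deleteEdges {s(x, y)}).Adj u v ↔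
      G.Adj u v ∧ ¬ ((u = x ∧ v = y) ∨ (u = y ∧ v = x)) := by
  simp [SimpleGraph.deleteEdges_adj]

section Shift

variable {G : SimpleGraph V} {m : ℕ} {x y : V} {c : V → V → ℕ}

lemma IsColoring.extend (h : IsColoring (G.deleteEdges {s(x, y)}) m c) (hxy : G.Adj x y)
    {α : ℕ} (hα : α < m) (hx : Misses c x α) (hy : Misses c y α) :
    IsColoring G m (recolor c x y α) := by
  have hs := h.symm
  have hl := h.lt_iff
  have hi := h.inj
  simp only [deleteEdges_adj'] at hl
  have hne := hxy.ne
  have hyx := hxy.symm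
  refine ⟨fun u v => ?_, fun u v => ?_, fun u v w => ?_⟩ <;> unfold recolor <;>
    unfold Misses at hx hy <;> grind

/-- Move the uncolored edge from `xy` to `yw`. -/
noncomputable def shift (m : ℕ) (c : V → V → ℕ) (x y w : V) : V → V → ℕ :=
  recolor (recolor c x y (c y w)) y w m

lemma IsColoring.shift (h : IsColoring (G.deleteEdges {s(x, y)}) m c) (hxy : G.Adj x y)
    {w : V} (hw : c y w < m) (hx : Misses c x (c y w)) :
    IsColoring (G.deleteEdges {s(y, w)}) m (shift m c x y w) := by
  have hs := h.symm
  have hl := h.lt_iff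
  have hi := h.inj
  simp only [deleteEdges_adj'] at hl
  have hne := hxy.ne
  have hyx := hxy.symm
  refine ⟨fun u v => ?_, fun u v => ?_, fun u v w => ?_⟩ <;>
    simp only [deleteEdges_adj', EdgeColoring.shift, recolor] <;>
    unfold Misses at hx <;> grind

end Shift

/-- The Kempe graph: edges of color `α` or `β`. -/
def kempe (c : V → V → ℕ) (α β : ℕ) : SimpleGraph V :=
  SimpleGraph.fromRel fun u v => c u v = α ∨ c u v = β

open Classical in
/-- Interchange the colors `α` and `β` on the Kempe component of `r`. -/
noncomputable def kempeSwap (c : V → V → ℕ) (α β : ℕ) (r : V) : V → V → ℕ :=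
  fun u v => if (kempe c α β).Reachable r u then Equiv.swap α β (c u v) else c u v

section Kempe

variable {H : SimpleGraph V} {m α β : ℕ} {c : V → V → ℕ}

lemma IsColoring.kempe_adj (h : IsColoring H m c) (hα : α < m) (hβ : β < m) {u v : V} :
    (kempe c α β).Adj u v ↔ c u v = α ∨ c u v = β := by
  have hs := h.symm u v
  have hl := h.lt_iff u v
  simp only [kempe, SimpleGraph.fromRel_adj, ← hs, or_self, and_iff_right_iff_imp]
  intro h1
  exact (hl.1 (by omega)).ne

lemma IsColoring.reachable_congr (h : IsColoring H m c) (hα : α < m) (hβ : β < m) {r u v : V}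
    (huv : c u v = α ∨ c u v = β) :
    (kempe c α β).Reachable r u ↔ (kempe c α β).Reachable r v := by
  have h1 := (h.kempe_adj hα hβ).2 huv
  exact ⟨fun h2 => h2.trans h1.reachable, fun h2 => h2.trans h1.symm.reachable⟩

lemma IsColoring.kempeSwap (h : IsColoring H m c) (hα : α < m) (hβ : β < m) (r : V) :
    IsColoring H m (kempeSwap c α β r) := by
  have hs := h.symm
  have hl := h.lt_iff
  have hi := h.inj
  have hc := fun u v => h.reachable_congr hα hβ (r := r) (u := u) (v := v)
  refine ⟨fun u v => ?_, fun u v => ?_, fun u v w => ?_⟩ <;>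
    simp only [EdgeColoring.kempeSwap, Equiv.swap_apply_def] <;> grind

lemma IsColoring.ncard_kempe_neighborSet_le (h : IsColoring H m c) (hα : α < m) (hβ : β < m)
    (v : V) : ((kempe c α β).neighborSet v).ncard ≤ 2 := by
  have h1 : (c v '' (kempe c α β).neighborSet v) ⊆ {α, β} := by
    rintro _ ⟨w, hw, rfl⟩
    simpa using (h.kempe_adj hα hβ).1 hw
  have h2 : Set.InjOn (c v) ((kempe c α β).neighborSet v) := by
    intro w hw w' _ hww
    rcases (h.kempe_adj hα hβ).1 hw with h3 | h3 <;> exact h.inj v w w' hww (by omega)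
  rw [← h2.ncard_image]
  exact (Set.ncard_le_ncard h1).trans (Set.ncard_insert_le _ _ |>.trans (by simp))

variable [Fintype V]

lemma IsColoring.ncard_kempe_neighborSet_le_one (h : IsColoring H m c) (hα : α < m) (hβ : β < m)
    {v : V} (hv : Misses c v α ∨ Misses c v β) : ((kempe c α β).neighborSet v).ncard ≤ 1 := by
  rw [Set.ncard_le_one]
  intro w hw w' hw'
  have h1 := (h.kempe_adj hα hβ).1 hw
  have h2 := (h.kempe_adj hα hβ).1 hw'
  have h3 := h.inj v w w'
  unfold Misses at hv
  grind

/-- A Kempe component is a path or a cycle, so it has at most two ends. -/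
lemma IsColoring.not_three_ends (h : IsColoring H m c) (hα : α < m) (hβ : β < m) {p q r : V}
    (hpq : p ≠ q) (hpr : p ≠ r) (hqr : q ≠ r)
    (hp : Misses c p α ∨ Misses c p β) (hq : Misses c q α ∨ Misses c q β)
    (hr : Misses c r α ∨ Misses c r β) :
    ¬ ((kempe c α β).Reachable r p ∧ (kempe c α β).Reachable r q) := by
  classical
  rintro ⟨h1, h2⟩
  set K := kempe c α β with hK
  set C := K.connectedComponentMk r with hC
  have hcon : C.toSimpleGraph.Connected := C.connected_toSimpleGraph
  have hcard := hcon.card_vert_le_card_edgeSet_add_one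
  have hsum := C.toSimpleGraph.sum_degrees_eq_twice_card_edges
  have hdeg : ∀ v : C, C.toSimpleGraph.degree v ≤ (K.neighborSet v.1).ncard := by
    intro v
    rw [← SimpleGraph.card_neighborSet_eq_degree, ← Nat.card_eq_fintype_card,
      Nat.card_coe_set_eq, ← Set.ncard_image_of_injective _ Subtype.val_injective]
    refine Set.ncard_le_ncard ?_ (Set.toFinite _)
    rintro _ ⟨w, hw, rfl⟩
    exact hw
  let P : C := ⟨p, SimpleGraph.ConnectedComponent.eq.2 h1.symm⟩
  let Q : C := ⟨q, SimpleGraph.ConnectedComponent.eq.2 h2.symm⟩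
  let R : C := ⟨r, rfl⟩
  have hle : ∑ v : C, C.toSimpleGraph.degree v + ({P, Q, R} : Finset C).card ≤ ∑ v : C, 2 := by
    rw [Finset.card_eq_sum_ones, ← Finset.sum_filter_add_sum_filter_not Finset.univ
      (· ∈ ({P, Q, R} : Finset C)) (fun v => C.toSimpleGraph.degree v),
      ← Finset.sum_filter_add_sum_filter_not Finset.univ
      (· ∈ ({P, Q, R} : Finset C)) (fun _ => 2)]
    rw [Finset.filter_mem_eq_inter, Finset.univ_inter]
    have ha : ∑ v ∈ ({P, Q, R} : Finset C), C.toSimpleGraph.degree v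
        + ∑ v ∈ ({P, Q, R} : Finset C), 1 ≤ ∑ v ∈ ({P, Q, R} : Finset C), 2 := by
      rw [← Finset.sum_add_distrib]
      refine Finset.sum_le_sum fun v hv => ?_
      have := hdeg v
      have : (K.neighborSet v.1).ncard ≤ 1 := by
        simp only [Finset.mem_insert, Finset.mem_singleton] at hv
        rcases hv with rfl | rfl | rfl
        · exact h.ncard_kempe_neighborSet_le_one hα hβ hp
        · exact h.ncard_kempe_neighborSet_le_one hα hβ hq
        · exact h.ncard_kempe_neighborSet_le_one hα hβ hr
      omega
    have hb := Finset.sum_le_sum fun v (_ : v ∈ Finset.univ.filter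
      (· ∉ ({P, Q, R} : Finset C))) => (hdeg v).trans (h.ncard_kempe_neighborSet_le hα hβ v.1)
    omega
  have h3 : ({P, Q, R} : Finset C).card = 3 :=
    Finset.card_eq_three.2 ⟨P, Q, R, fun hh => hpq (congrArg Subtype.val hh),
      fun hh => hpr (congrArg Subtype.val hh), fun hh => hqr (congrArg Subtype.val hh), rfl⟩
  rw [Nat.card_eq_fintype_card, Nat.card_eq_fintype_card, ← SimpleGraph.edgeFinset_card] at hcard
  simp only [Finset.sum_const, Finset.card_univ, smul_eq_mul] at hle
  omega

end Kempe

section Fan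

variable {G : SimpleGraph V} {m : ℕ} {x y : V} {c : V → V → ℕ}

lemma IsColoring.ne_of_lt (h : IsColoring (G.deleteEdges {s(x, y)}) m c) {w : V}
    (hw : c y w < m) : w ≠ x ∧ w ≠ y := by
  have := (h.lt_iff y w).1 hw
  rw [deleteEdges_adj'] at this
  have h2 := this.1.ne
  grind

lemma misses_shift_left {w : V} {δ : ℕ} (hδ : δ < m) (hy : Misses c y δ) : Misses (EdgeColoring.shift m c x y w) y δ := by
  intro v
  have h1 := hy v
  have h2 := hy w
  simp only [EdgeColoring.shift, recolor]
  grind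

lemma IsColoring.misses_shift_right (h : IsColoring (G.deleteEdges {s(x, y)}) m c) {w : V} {δ : ℕ}
    (hw : c y w < m) (hδ : δ < m) (hwδ : Misses c w δ ∨ δ = c y w) :
    Misses (EdgeColoring.shift m c x y w) w δ := by
  intro v
  have h1 := h.ne_of_lt hw
  have h2 := h.inj w v y
  have h3 := h.symm w y
  unfold Misses at hwδ
  simp only [EdgeColoring.shift, recolor]
  grind

lemma shift_apply_of_ne {w z v : V} (hx : z ≠ x) (hy : z ≠ y) (hw : z ≠ w) :
    EdgeColoring.shift m c x y w z v = c z v := by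
  simp only [EdgeColoring.shift, recolor]
  grind

lemma shift_apply_left {w v : V} (hx : v ≠ x) (hw : v ≠ w) :
    EdgeColoring.shift m c x y w y v = c y v := by
  simp only [EdgeColoring.shift, recolor]
  grind

lemma shift_apply_right {w v : V} (hx : w ≠ x) (hy : w ≠ y) (hv : v ≠ y) :
    EdgeColoring.shift m c x y w w v = c w v := by
  simp only [EdgeColoring.shift, recolor]
  grind

lemma IsColoring.disjoint (hG : ∀ c, ¬ IsColoring G m c) (hxy : G.Adj x y)
    (h : IsColoring (G.deleteEdges {s(x, y)}) m c) {α : ℕ} (hα : α < m) (hx : Misses c x α) :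
    ¬ Misses c y α := fun hy => hG _ (h.extend hxy hα hx hy)

lemma IsColoring.adj_of_lt (h : IsColoring (G.deleteEdges {s(x, y)}) m c) {u v : V}
    (huv : c u v < m) : G.Adj u v :=
  (deleteEdges_adj'.1 ((h.lt_iff u v).1 huv)).1

lemma IsColoring.linked (hG : ∀ c, ¬ IsColoring G m c) (hxy : G.Adj x y)
    (h : IsColoring (G.deleteEdges {s(x, y)}) m c) {α β : ℕ} (hα : α < m) (hβ : β < m)
    (hx : Misses c x β) (hy : Misses c y α) : (kempe c α β).Reachable x y := by
  by_contra hr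
  refine (h.kempeSwap hα hβ x).disjoint hG hxy hα (fun v => ?_) (fun v => ?_)
  · have := hx v
    simp only [EdgeColoring.kempeSwap, SimpleGraph.Reachable.refl, if_true, Equiv.swap_apply_def]
    grind
  · have := hy v
    simp only [EdgeColoring.kempeSwap, if_neg hr]
    grind

lemma misses_congr {c c' : V → V → ℕ} {v : V} (h : ∀ w, c' v w = c v w) {α : ℕ} :
    Misses c' v α ↔ Misses c v α := by
  simp only [Misses, h]

lemma misses_of_swap {c c' : V → V → ℕ} {v : V} {α β δ : ℕ}
    (h : ∀ w, c' v w = c v w ∨ c' v w = Equiv.swap α β (c v w)) (hα : δ ≠ α) (hβ : δ ≠ β)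
    (hv : Misses c v δ) : Misses c' v δ := by
  intro w
  have h1 := h w
  have h2 := hv w
  rw [Equiv.swap_apply_def] at h1
  grind

lemma misses_swap {c c' : V → V → ℕ} {v : V} {α β δ : ℕ}
    (h : ∀ w, c' v w = Equiv.swap α β (c v w)) (hv : Misses c v (Equiv.swap α β δ)) :
    Misses c' v δ := by
  intro w hw
  rw [h w] at hw
  exact hv w (by rw [← hw, Equiv.swap_apply_self])

lemma IsColoring.fan_not_misses_center (hG : ∀ c, ¬ IsColoring G m c) (hxy : G.Adj x y)
    (h : IsColoring (G.deleteEdges {s(x, y)}) m c) {v : V} (hv : c y v < m)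
    (hxv : Misses c x (c y v)) {δ : ℕ} (hδ : δ < m) (hvδ : Misses c v δ) : ¬ Misses c y δ :=
  fun hy => (h.shift hxy hv hxv).disjoint hG (h.adj_of_lt hv) hδ
    (misses_shift_left hδ hy) (h.misses_shift_right hv hδ (.inl hvδ))

lemma IsColoring.fan_two_not_misses_center (hG : ∀ c, ¬ IsColoring G m c) (hxy : G.Adj x y)
    (h : IsColoring (G.deleteEdges {s(x, y)}) m c) {v w : V} (hv : c y v < m)
    (hxv : Misses c x (c y v)) (hw : c y w < m) (hvw : Misses c v (c y w)) {δ : ℕ} (hδ : δ < m)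
    (hwδ : Misses c w δ) : ¬ Misses c y δ := by
  intro hy
  have hnv := h.ne_of_lt hv
  have hnw := h.ne_of_lt hw
  have hne : w ≠ v := by
    rintro rfl
    exact hvw y (h.symm _ _)
  have hrow : EdgeColoring.shift m c x y v y w = c y w := shift_apply_left hnw.1 hne
  have h1 := h.shift hxy hv hxv
  rw [Sym2.eq_swap] at h1
  refine h1.fan_not_misses_center hG (h.adj_of_lt hv).symm (v := w) (by rwa [hrow]) ?_ hδ ?_
    (misses_shift_left hδ hy)
  · rw [hrow]
    exact h.misses_shift_right hv hw (.inl hvw)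
  · exact (misses_congr fun z => shift_apply_of_ne hnw.1 hnw.2 hne).2 hwδ

variable [Fintype V]

lemma IsColoring.exists_swap (hG : ∀ c, ¬ IsColoring G m c) (hxy : G.Adj x y)
    (h : IsColoring (G.deleteEdges {s(x, y)}) m c) {α β : ℕ} (hα : α < m) (hβ : β < m)
    (hx : Misses c x β) (hy : Misses c y α) {u : V} (hux : u ≠ x) (huy : u ≠ y)
    (hu : Misses c u α ∨ Misses c u β) :
    ∃ c', IsColoring (G.deleteEdges {s(x, y)}) m c' ∧ (∀ v, c' x v = c x v) ∧
      (∀ v, c' y v = c y v) ∧ (∀ v, c' u v = Equiv.swap α β (c u v)) ∧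
      ∀ z v, c' z v = c z v ∨ c' z v = Equiv.swap α β (c z v) := by
  have hr := h.linked hG hxy hα hβ hx hy
  have h3 := h.not_three_ends hα hβ hxy.ne hux.symm huy.symm (.inr hx) (.inl hy) hu
  have hnx : ¬ (kempe c α β).Reachable u x := fun hh => h3 ⟨hh, hh.trans hr⟩
  have hny : ¬ (kempe c α β).Reachable u y := fun hh => h3 ⟨hh.trans hr.symm, hh⟩
  refine ⟨_, h.kempeSwap hα hβ u, fun v => if_neg hnx, fun v => if_neg hny, fun v =>
    if_pos (SimpleGraph.Reachable.refl u), fun z v => ?_⟩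
  unfold EdgeColoring.kempeSwap
  split_ifs <;> simp

lemma IsColoring.fan_not_misses_tip (hG : ∀ c, ¬ IsColoring G m c) (hxy : G.Adj x y)
    (h : IsColoring (G.deleteEdges {s(x, y)}) m c) {α : ℕ} (hα : α < m) (hy : Misses c y α)
    {v : V} (hv : c y v < m) (hxv : Misses c x (c y v)) {δ : ℕ} (hδ : δ < m)
    (hvδ : Misses c v δ) : ¬ Misses c x δ := by
  intro hx
  have hne := h.ne_of_lt hv
  obtain ⟨c', h', hx', hy', hv', -⟩ :=
    h.exists_swap hG hxy hα hδ hx hy hne.1 hne.2 (.inr hvδ)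
  refine h'.fan_not_misses_center hG hxy (v := v) (by rwa [hy']) ?_ hα ?_ ((misses_congr hy').2 hy)
  · rwa [hy', misses_congr hx']
  · exact misses_swap hv' (by simpa using hvδ)

lemma IsColoring.fan_disjoint (hG : ∀ c, ¬ IsColoring G m c) (hxy : G.Adj x y)
    (h : IsColoring (G.deleteEdges {s(x, y)}) m c) {α : ℕ} (hα : α < m) (hy : Misses c y α)
    {v w : V} (hvw : v ≠ w) (hv : c y v < m) (hxv : Misses c x (c y v)) (hw : c y w < m)
    (hxw : Misses c x (c y w)) {δ : ℕ} (hδ : δ < m) (hvδ : Misses c v δ) : ¬ Misses c w δ := by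
  intro hwδ
  have key : ∀ u, u ≠ y → c y u < m → Misses c x (c y u) → Misses c u δ →
      (kempe c α δ).Reachable u y := by
    intro u huy hu hxu huδ
    by_contra hr
    have hxδ := h.fan_not_misses_tip hG hxy hα hy hu hxu hδ huδ
    have hxα : ¬ Misses c x α := fun hx => h.disjoint hG hxy hα hx hy
    have hrow : ∀ z, EdgeColoring.kempeSwap c α δ u y z = c y z := fun z => if_neg hr
    refine (h.kempeSwap hα hδ u).fan_not_misses_center hG hxy (v := u) (by rwa [hrow]) ?_ hα ?_
      ((misses_congr hrow).2 hy)
    · rw [hrow]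
      refine misses_of_swap (α := α) (β := δ) (fun z => ?_) ?_ ?_ hxu
      · unfold EdgeColoring.kempeSwap
        split_ifs <;> simp
      · rintro h1
        exact hxα (h1 ▸ hxu)
      · rintro h1
        exact hxδ (h1 ▸ hxu)
    · exact misses_swap (β := δ) (fun z => if_pos (SimpleGraph.Reachable.refl u))
        (by simpa using huδ)
  have hv2 := (h.ne_of_lt hv).2
  have hw2 := (h.ne_of_lt hw).2
  exact h.not_three_ends hα hδ hvw hv2 hw2 (.inr hvδ) (.inr hwδ) (.inl hy)
    ⟨(key v hv2 hv hxv hvδ).symm, (key w hw2 hw hxw hwδ).symm⟩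

lemma IsColoring.fan_two_not_misses_tip (hG : ∀ c, ¬ IsColoring G m c) (hxy : G.Adj x y)
    (h : IsColoring (G.deleteEdges {s(x, y)}) m c) {α : ℕ} (hα : α < m) (hy : Misses c y α)
    {v w : V} (hv : c y v < m) (hxv : Misses c x (c y v)) (hw : c y w < m)
    (hvw : Misses c v (c y w)) {δ : ℕ} (hδ : δ < m) (hwδ : Misses c w δ) : ¬ Misses c x δ := by
  intro hx
  have hne := h.ne_of_lt hw
  obtain ⟨c', h', hx', hy', hw', hall⟩ :=
    h.exists_swap hG hxy hα hδ hx hy hne.1 hne.2 (.inr hwδ)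
  refine h'.fan_two_not_misses_center hG hxy (v := v) (w := w) (by rwa [hy']) ?_ (by rwa [hy'])
    ?_ hα ?_ ((misses_congr hy').2 hy)
  · rwa [hy', misses_congr hx']
  · rw [hy']
    refine misses_of_swap (hall v) (fun h1 => hy w h1) (fun h1 => ?_) hvw
    exact h.fan_not_misses_tip hG hxy hα hy hv hxv hw hvw (h1 ▸ hx)
  · exact misses_swap hw' (by simpa using hwδ)

end Fan

section Kierstead

variable {G : SimpleGraph V} {x y w u : V} {c : V → V → ℕ}

lemma IsColoring.kierstead_base {m k o : ℕ} (hG : ∀ c, ¬ IsColoring G m c) (hxy : G.Adj x y)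
    (h : IsColoring (G.deleteEdges {s(x, y)}) m c) (hux : u ≠ x) (huy : u ≠ y) (hwu : w ≠ u)
    (hk : k < m) (ho : o < m) (hko : k ≠ o) (hx : Misses c x k) (hy : Misses c y o)
    (hyw : c y w = k) (hwo : c w u = o) (hu : Misses c u k) : False := by
  subst hyw
  have hnw := h.ne_of_lt hk
  have h1 := h.shift hxy hk hx
  have hrow : EdgeColoring.shift m c x y w w u = c w u := shift_apply_right hnw.1 hnw.2 huy
  have hrow' : ∀ z, EdgeColoring.shift m c x y w u z = c u z :=
    fun z => shift_apply_of_ne hux huy hwu.symm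
  refine h1.fan_not_misses_center hG (h.adj_of_lt hk) (v := u) (by rwa [hrow, hwo]) ?_ hk
    ((misses_congr hrow').2 hu) (h.misses_shift_right hk hk (.inr rfl))
  rw [hrow, hwo]
  exact misses_shift_left ho hy

variable [Fintype V]

/-- A Kierstead path `x y w u` whose end `x` misses all but one color forces `u` to have degree
at least three. -/
lemma IsColoring.kierstead (hG : ∀ c, ¬ IsColoring G 4 c) (hxy : G.Adj x y) {k o d e : ℕ}
    (hux : u ≠ x) (huy : u ≠ y) (hwu : w ≠ u) (hk : k < 4) (ho : o < 4) (hko : k ≠ o)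
    (h : IsColoring (G.deleteEdges {s(x, y)}) 4 c) (hx : ∀ α < 4, α ≠ o → Misses c x α)
    (hy : Misses c y o) (hyw : c y w = k) (hd : d < 4) (hdk : d ≠ k) (hwd : c w u = d)
    (hu : ∀ α < 4, α ≠ d → α ≠ e → Misses c u α) : False := by
  let P : ℕ → ℕ → Prop := fun d e => ∃ c, IsColoring (G.deleteEdges {s(x, y)}) 4 c ∧
    (∀ α < 4, α ≠ o → Misses c x α) ∧ Misses c y o ∧ c y w = k ∧ c w u = d ∧
    ∀ α < 4, α ≠ d → α ≠ e → Misses c u α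
  have base : ∀ e, e ≠ k → ¬ P o e := by
    rintro e he ⟨c, h, hx, hy, hyw, hwd, hu⟩
    exact h.kierstead_base hG hxy hux huy hwu hk ho hko (hx k hk hko) hy hyw hwd
      (hu k hk hko he.symm)
  have step : ∀ i < 4, i ≠ o → ∀ d e, (o ≠ d ∧ o ≠ e) ∨ (i ≠ d ∧ i ≠ e) → P d e →
      P (Equiv.swap o i d) (Equiv.swap o i e) := by
    rintro i hi hio d e hde ⟨c, h, hx, hy, hyw, hwd, hu⟩
    obtain ⟨c', h', hx', hy', hu', -⟩ := h.exists_swap hG hxy ho hi (hx i hi hio) hy hux huy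
      (hde.imp (fun hh => hu o ho hh.1 hh.2) (fun hh => hu i hi hh.1 hh.2))
    refine ⟨c', h', fun α hα hαo => (misses_congr hx').2 (hx α hα hαo), (misses_congr hy').2 hy,
      by rw [hy', hyw], by rw [h'.symm, hu', h.symm, hwd], fun α hα h1 h2 => ?_⟩
    refine misses_swap hu' (hu _ ?_ (fun h3 => h1 ?_) (fun h3 => h2 ?_))
    · rw [Equiv.swap_apply_def]
      split_ifs <;> assumption
    · rw [← h3, Equiv.swap_apply_self]
    · rw [← h3, Equiv.swap_apply_self]
  have generic : ∀ a < 4, ∀ e, a ≠ o → a ≠ k → e ≠ o → e ≠ k → e ≠ a → ¬ P a e := by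
    intro a ha e hao hak heo hek hea hP
    have h1 := step a ha hao a e (.inl ⟨hao.symm, heo.symm⟩) hP
    rw [Equiv.swap_apply_right, Equiv.swap_apply_of_ne_of_ne heo hea] at h1
    exact base e hek h1
  have free : ∀ a < 4, a ≠ o → a ≠ k → ¬ P a o := by
    intro a ha hao hak hP
    obtain ⟨b, hb, hbo, hbk, hba⟩ : ∃ b < 4, b ≠ o ∧ b ≠ k ∧ b ≠ a := by
      by_contra! hcon
      have := hcon 0
      have := hcon 1
      have := hcon 2
      have := hcon 3
      omega
    have h1 := step b hb hbo a o (.inr ⟨hba, hbo⟩) hP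
    rw [Equiv.swap_apply_left, Equiv.swap_apply_of_ne_of_ne hao hba.symm] at h1
    exact generic a ha b hao hak hbo hbk hba h1
  have blocked : ∀ a < 4, a ≠ o → a ≠ k → ¬ P a k := by
    intro a ha hao hak hP
    have h1 := step k hk hko a k (.inl ⟨hao.symm, hko.symm⟩) hP
    rw [Equiv.swap_apply_right, Equiv.swap_apply_of_ne_of_ne hao hak] at h1
    exact free a ha hao hak h1
  have hP : P d e := ⟨c, h, hx, hy, hyw, hwd, hu⟩
  by_cases hdo : d = o
  · rw [hdo] at hP
    by_cases hek : e = k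
    · rw [hek] at hP
      obtain ⟨a, ha, hao, hak⟩ : ∃ a < 4, a ≠ o ∧ a ≠ k := by
        by_contra! hcon
        have := hcon 0
        have := hcon 1
        have := hcon 2
        omega
      have h1 := step a ha hao o k (.inr ⟨hao, hak⟩) hP
      rw [Equiv.swap_apply_left, Equiv.swap_apply_of_ne_of_ne hko hak.symm] at h1
      exact blocked a ha hao hak h1
    · exact base e hek hP
  · by_cases heo : e = o
    · exact free d hd hdo hdk (heo ▸ hP)
    · by_cases hek : e = k
      · exact blocked d hd hdo hdk (hek ▸ hP)
      · by_cases hed : e = d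
        · have h1 := step d hd hdo d e (.inl ⟨Ne.symm hdo, Ne.symm heo⟩) hP
          rw [hed, Equiv.swap_apply_right] at h1
          exact base o (Ne.symm hko) h1
        · exact generic d hd e hdo hdk heo hek hed hP

end Kierstead

section Missing

open Classical in
/-- The colors below `m` that do not appear at `v`. -/
noncomputable def missing (m : ℕ) (c : V → V → ℕ) (v : V) : Finset ℕ :=
  (Finset.range m).filter (Misses c v)

lemma mem_missing {m : ℕ} {c : V → V → ℕ} {v : V} {α : ℕ} :
    α ∈ missing m c v ↔ α < m ∧ Misses c v α := by
  simp [missing]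

lemma exists_of_notMem_missing {m : ℕ} {c : V → V → ℕ} {v : V} {α : ℕ} (hα : α < m)
    (h : α ∉ missing m c v) : ∃ w, c v w = α := by
  simpa [mem_missing, hα, Misses] using h

variable {G H : SimpleGraph V} {m : ℕ} {x y : V} {c : V → V → ℕ}

lemma IsColoring.disjoint_missing (hG : ∀ c, ¬ IsColoring G m c) (hxy : G.Adj x y)
    (h : IsColoring (G.deleteEdges {s(x, y)}) m c) :
    Disjoint (missing m c x) (missing m c y) := by
  rw [Finset.disjoint_left]
  intro α hx hy
  rw [mem_missing] at hx hy
  exact h.disjoint hG hxy hx.1 hx.2 hy.2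

lemma missing_subset : missing m c x ⊆ Finset.range m := by
  classical exact Finset.filter_subset _ _

lemma deg_deleteEdges_of_ne {v : V} (hx : v ≠ x) (hy : v ≠ y) :
    deg (G.deleteEdges {s(x, y)}) v = deg G v := by
  have h1 : (G.deleteEdges {s(x, y)}).neighborSet v = G.neighborSet v := by
    ext w
    simp only [SimpleGraph.mem_neighborSet, deleteEdges_adj']
    grind
  rw [deg, deg, h1]

lemma IsColoring.card_missing_add_card_missing_le (hG : ∀ c, ¬ IsColoring G m c) (hxy : G.Adj x y)
    (h : IsColoring (G.deleteEdges {s(x, y)}) m c) :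
    (missing m c x).card + (missing m c y).card ≤ m := by
  rw [← Finset.card_union_of_disjoint (h.disjoint_missing hG hxy)]
  simpa using Finset.card_le_card
    (Finset.union_subset (missing_subset (m := m) (c := c) (x := x)) (missing_subset (x := y)))

variable [Fintype V]

lemma IsColoring.card_missing (h : IsColoring H m c) (v : V) :
    (missing m c v).card + deg H v = m := by
  classical
  have h1 : c v '' H.neighborSet v = ↑((Finset.range m).filter fun α => ¬ Misses c v α) := by
    ext α
    simp only [Set.mem_image, SimpleGraph.mem_neighborSet, Finset.coe_filter, Finset.mem_range,
      Set.mem_ofPred_eq, Misses, not_forall, not_not]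
    constructor
    · rintro ⟨w, hw, rfl⟩
      exact ⟨(h.lt_iff v w).2 hw, w, rfl⟩
    · rintro ⟨hα, w, rfl⟩
      exact ⟨w, (h.lt_iff v w).1 hα, rfl⟩
  have h2 : Set.InjOn (c v) (H.neighborSet v) := fun w hw w' _ hww =>
    h.inj v w w' hww ((h.lt_iff v w).2 hw)
  rw [deg, ← h2.ncard_image, h1, Set.ncard_coe_finset, missing,
    Finset.card_filter_add_card_filter_not, Finset.card_range]

lemma deg_deleteEdges_left (hxy : G.Adj x y) : deg (G.deleteEdges {s(x, y)}) x + 1 = deg G x := by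
  have h1 : (G.deleteEdges {s(x, y)}).neighborSet x = G.neighborSet x \ {y} := by
    ext v
    have := hxy.ne
    simp only [SimpleGraph.mem_neighborSet, deleteEdges_adj', Set.mem_sdiff, Set.mem_singleton_iff]
    grind
  rw [deg, deg, h1]
  exact Set.ncard_sdiff_singleton_add_one hxy (Set.toFinite _)

lemma IsColoring.card_missing_left (hxy : G.Adj x y)
    (h : IsColoring (G.deleteEdges {s(x, y)}) m c) : (missing m c x).card + deg G x = m + 1 := by
  have := h.card_missing x
  have := deg_deleteEdges_left hxy
  omega

lemma IsColoring.card_missing_right (hxy : G.Adj x y)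
    (h : IsColoring (G.deleteEdges {s(x, y)}) m c) : (missing m c y).card + deg G y = m + 1 := by
  rw [Sym2.eq_swap] at h
  exact h.card_missing_left hxy.symm

lemma IsColoring.card_missing_of_ne (h : IsColoring (G.deleteEdges {s(x, y)}) m c) {v : V}
    (hx : v ≠ x) (hy : v ≠ y) : (missing m c v).card + deg G v = m := by
  rw [← deg_deleteEdges_of_ne (G := G) hx hy]
  exact h.card_missing v

/-- Vizing's theorem for graphs of maximum degree at most four: with at least five colors, a
coloring of all edges but one yields a coloring of the whole graph. -/
lemma IsColoring.false_of_five_le (hG : ∀ c, ¬ IsColoring G m c) (hxy : G.Adj x y)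
    (h : IsColoring (G.deleteEdges {s(x, y)}) m c) (hm : 5 ≤ m) (hdeg : ∀ v, deg G v ≤ 4) :
    False := by
  have hcx := h.card_missing_left hxy
  have hcy := h.card_missing_right hxy
  have hdx := hdeg x
  have hdy := hdeg y
  obtain ⟨o, ho⟩ : (missing m c y).Nonempty := Finset.card_pos.1 (by omega)
  obtain ⟨γ, hγ, γ', hγ', hne⟩ := Finset.one_lt_card.1 (by omega : 1 < (missing m c x).card)
  have hxyd := Finset.disjoint_left.1 (h.disjoint_missing hG hxy)
  have hol := (mem_missing.1 ho).1
  have hoy := (mem_missing.1 ho).2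
  have key : ∀ γ ∈ missing m c x, ∃ v, c y v = γ ∧ ∃ δ < m, Misses c v δ ∧
      δ ∉ missing m c y ∧ δ ∉ missing m c x := by
    intro γ hγ
    have hγm := mem_missing.1 hγ
    obtain ⟨v, rfl⟩ := exists_of_notMem_missing hγm.1 (hxyd hγ)
    have hn := h.ne_of_lt hγm.1
    have hcv := h.card_missing_of_ne hn.1 hn.2
    have hdv := hdeg v
    obtain ⟨δ, hδ⟩ : (missing m c v).Nonempty := Finset.card_pos.1 (by omega)
    rw [mem_missing] at hδ
    exact ⟨v, rfl, δ, hδ.1, hδ.2,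
      fun hh => h.fan_not_misses_center hG hxy hγm.1 hγm.2 hδ.1 hδ.2 (mem_missing.1 hh).2,
      fun hh => h.fan_not_misses_tip hG hxy hol hoy hγm.1 hγm.2 hδ.1 hδ.2 (mem_missing.1 hh).2⟩
  obtain ⟨v, hv, δ, hδ, hvδ, hδy, hδx⟩ := key γ hγ
  obtain ⟨v', hv', δ', hδ', hvδ', hδy', hδx'⟩ := key γ' hγ'
  have hvv : v ≠ v' := by
    rintro rfl
    exact hne (hv.symm.trans hv')
  have hδδ : δ ≠ δ' := by
    rintro rfl
    rw [mem_missing] at hγ hγ'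
    subst hv hv'
    exact h.fan_disjoint hG hxy hol hoy hvv hγ.1 hγ.2 hγ'.1 hγ'.2 hδ hvδ hvδ'
  have hsub : ({γ, γ', δ, δ'} : Finset ℕ) ⊆ Finset.range m \ missing m c y := by
    have h1 := missing_subset hγ
    have h2 := missing_subset hγ'
    rw [Finset.mem_range] at h1 h2
    have h3 := hxyd hγ
    have h4 := hxyd hγ'
    intro α hα
    simp only [Finset.mem_insert, Finset.mem_singleton] at hα
    simp only [Finset.mem_sdiff, Finset.mem_range]
    grind
  have hcard := Finset.card_le_card hsub
  rw [Finset.card_sdiff_of_subset missing_subset, Finset.card_range] at hcard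
  have h4 : ({γ, γ', δ, δ'} : Finset ℕ).card = 4 := by
    have a1 : γ ≠ δ := fun hh => hδx (hh ▸ hγ)
    have a2 : γ ≠ δ' := fun hh => hδx' (hh ▸ hγ)
    have a3 : γ' ≠ δ := fun hh => hδx (hh ▸ hγ')
    have a4 : γ' ≠ δ' := fun hh => hδx' (hh ▸ hγ')
    simp [*]
  omega

end Missing

section DegreeFour

variable [Fintype V] {G : SimpleGraph V} {x y : V}

/-- `G` behaves like a `4`-critical graph with respect to `4`-edge-colorings. -/
structure IsCriticalFour (G : SimpleGraph V) : Prop where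
  deg_le : ∀ v, deg G v ≤ 4
  not_isColoring : ∀ c, ¬ IsColoring G 4 c
  exists_isColoring : ∀ x y, G.Adj x y → ∃ c, IsColoring (G.deleteEdges {s(x, y)}) 4 c

lemma IsCriticalFour.six_le (hG : IsCriticalFour G) (hxy : G.Adj x y) :
    6 ≤ deg G x + deg G y := by
  obtain ⟨c, h⟩ := hG.exists_isColoring x y hxy
  have := h.card_missing_left hxy
  have := h.card_missing_right hxy
  have := h.card_missing_add_card_missing_le hG.not_isColoring hxy
  omega

lemma IsColoring.missing_subset_of_fan {c : V → V → ℕ} (hG : IsCriticalFour G) (hxy : G.Adj x y)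
    (h : IsColoring (G.deleteEdges {s(x, y)}) 4 c) {v : V} (hv : c y v ∈ missing 4 c x) :
    missing 4 c v ⊆ Finset.range 4 \ (missing 4 c x ∪ missing 4 c y) := by
  have hcy := h.card_missing_right hxy
  have hdy := hG.deg_le y
  obtain ⟨o, ho⟩ : (missing 4 c y).Nonempty := Finset.card_pos.1 (by omega)
  rw [mem_missing] at hv ho
  intro δ hδ
  rw [mem_missing] at hδ
  simp only [Finset.mem_sdiff, Finset.mem_union, Finset.mem_range, mem_missing, hδ.1, true_and]
  rintro (hx | hy)
  · exact h.fan_not_misses_tip hG.not_isColoring hxy ho.1 ho.2 hv.1 hv.2 hδ.1 hδ.2 hx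
  · exact h.fan_not_misses_center hG.not_isColoring hxy hv.1 hv.2 hδ.1 hδ.2 hy

lemma IsColoring.card_uncovered {c : V → V → ℕ} (hG : IsCriticalFour G) (hxy : G.Adj x y)
    (h : IsColoring (G.deleteEdges {s(x, y)}) 4 c) :
    (Finset.range 4 \ (missing 4 c x ∪ missing 4 c y)).card + 6 = deg G x + deg G y := by
  have hcx := h.card_missing_left hxy
  have hcy := h.card_missing_right hxy
  have h3 := h.card_missing_add_card_missing_le hG.not_isColoring hxy
  rw [Finset.card_sdiff_of_subset (Finset.union_subset missing_subset missing_subset),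
    Finset.card_union_of_disjoint (h.disjoint_missing hG.not_isColoring hxy), Finset.card_range]
  omega

lemma IsCriticalFour.deg_eq_four_of_deg_two (hG : IsCriticalFour G) (hxy : G.Adj x y)
    (hx : deg G x = 2) : deg G y = 4 := by
  have := hG.six_le hxy
  have := hG.deg_le y
  omega

lemma IsCriticalFour.deg_eq_four_of_two_path (hG : IsCriticalFour G) (hxy : G.Adj x y)
    (hx : deg G x = 2) {v : V} (hyv : G.Adj y v) (hvx : v ≠ x) : deg G v = 4 := by
  obtain ⟨c, h⟩ := hG.exists_isColoring x y hxy
  have hy := hG.deg_eq_four_of_deg_two hxy hx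
  have hunc := h.card_uncovered hG hxy
  have hlt : c y v < 4 := by
    rw [h.lt_iff, deleteEdges_adj']
    have := hxy.ne
    grind
  have hv : c y v ∈ missing 4 c x := by
    by_contra hcon
    have : c y v ∈ Finset.range 4 \ (missing 4 c x ∪ missing 4 c y) := by
      simp only [Finset.mem_sdiff, Finset.mem_range, Finset.mem_union, hlt, hcon, true_and,
        false_or]
      exact fun hh => (mem_missing.1 hh).2 v rfl
    have := Finset.card_pos.2 ⟨_, this⟩
    omega
  have hcv := h.card_missing_of_ne hvx hyv.ne'
  have := Finset.card_le_card (h.missing_subset_of_fan hG hxy hv)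
  omega

/-- Vizing's adjacency lemma at a vertex of degree three. -/
lemma IsCriticalFour.exists_two_of_deg_three (hG : IsCriticalFour G) (hxy : G.Adj x y)
    (hx : deg G x = 3) : ∃ v w, v ≠ w ∧ G.Adj y v ∧ G.Adj y w ∧ deg G v = 4 ∧ deg G w = 4 := by
  obtain ⟨c, h⟩ := hG.exists_isColoring x y hxy
  have hcx := h.card_missing_left hxy
  have hcy := h.card_missing_right hxy
  have hdy := hG.deg_le y
  have hunc := h.card_uncovered hG hxy
  obtain ⟨o, ho⟩ : (missing 4 c y).Nonempty := Finset.card_pos.1 (by omega)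
  obtain ⟨γ, hγ, γ', hγ', hne⟩ := Finset.one_lt_card.1 (by omega : 1 < (missing 4 c x).card)
  have hxyd := Finset.disjoint_left.1 (h.disjoint_missing hG.not_isColoring hxy)
  have key : ∀ v, c y v ∈ missing 4 c x → deg G v ≠ 4 → ∀ v', c y v' ∈ missing 4 c x → v ≠ v' →
      ∃ v w, v ≠ w ∧ G.Adj y v ∧ G.Adj y w ∧ deg G v = 4 ∧ deg G w = 4 := by
    intro v hv hv4 v' hv' hvv
    have hnv := h.ne_of_lt (mem_missing.1 hv).1
    have hnv' := h.ne_of_lt (mem_missing.1 hv').1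
    have hcv := h.card_missing_of_ne hnv.1 hnv.2
    have hcv' := h.card_missing_of_ne hnv'.1 hnv'.2
    have hdv := hG.deg_le v
    obtain ⟨κ, hκ⟩ : (missing 4 c v).Nonempty := Finset.card_pos.1 (by omega)
    have hκU := h.missing_subset_of_fan hG hxy hv hκ
    have huniq : ∀ δ ∈ Finset.range 4 \ (missing 4 c x ∪ missing 4 c y), δ = κ :=
      fun δ hδ => Finset.card_le_one.1 (by omega) _ hδ _ hκU
    have hκy : κ ∉ missing 4 c y := fun hh =>
      (Finset.mem_sdiff.1 hκU).2 (Finset.mem_union_right _ hh)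
    rw [mem_missing] at hv hv' hκ ho
    obtain ⟨w, rfl⟩ := exists_of_notMem_missing hκ.1 hκy
    have hnw := h.ne_of_lt hκ.1
    have hcw := h.card_missing_of_ne hnw.1 hnw.2
    have hv'0 : missing 4 c v' = ∅ := by
      rw [Finset.eq_empty_iff_forall_notMem]
      intro δ hδ
      rw [huniq δ (h.missing_subset_of_fan hG hxy (mem_missing.2 hv') hδ), mem_missing] at hδ
      exact h.fan_disjoint hG.not_isColoring hxy ho.1 ho.2 hvv hv.1 hv.2 hv'.1 hv'.2 hκ.1 hκ.2 hδ.2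
    have hw0 : missing 4 c w = ∅ := by
      rw [Finset.eq_empty_iff_forall_notMem]
      intro δ hδ
      rw [mem_missing] at hδ
      have hδU : δ ∈ Finset.range 4 \ (missing 4 c x ∪ missing 4 c y) := by
        simp only [Finset.mem_sdiff, Finset.mem_union, Finset.mem_range, mem_missing, hδ.1,
          true_and]
        rintro (hh | hh)
        · exact h.fan_two_not_misses_tip hG.not_isColoring hxy ho.1 ho.2 hv.1 hv.2 hκ.1 hκ.2
            hδ.1 hδ.2 hh
        · exact h.fan_two_not_misses_center hG.not_isColoring hxy hv.1 hv.2 hκ.1 hκ.2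
            hδ.1 hδ.2 hh
      rw [huniq δ hδU] at hδ
      exact hδ.2 y (h.symm _ _)
    rw [hv'0, Finset.card_empty, zero_add] at hcv'
    rw [hw0, Finset.card_empty, zero_add] at hcw
    refine ⟨v', w, ?_, h.adj_of_lt hv'.1, h.adj_of_lt hκ.1, hcv', hcw⟩
    rintro rfl
    exact (Finset.mem_sdiff.1 hκU).2 (Finset.mem_union_left _ (mem_missing.2 hv'))
  obtain ⟨v, rfl⟩ := exists_of_notMem_missing (mem_missing.1 hγ).1 (hxyd hγ)
  obtain ⟨v', rfl⟩ := exists_of_notMem_missing (mem_missing.1 hγ').1 (hxyd hγ')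
  have hvv : v ≠ v' := fun hh => hne (hh ▸ rfl)
  by_cases hv4 : deg G v = 4
  · by_cases hv4' : deg G v' = 4
    · exact ⟨v, v', hvv, h.adj_of_lt (mem_missing.1 hγ).1, h.adj_of_lt (mem_missing.1 hγ').1,
        hv4, hv4'⟩
    · exact key v' hγ' hv4' v hγ hvv.symm
  · exact key v hγ hv4 v' hγ' hvv

/-- Two vertices of degree two are not at the ends of a path with three edges. -/
lemma IsCriticalFour.not_two_path_two (hG : IsCriticalFour G) {w u : V} (hxy : G.Adj x y)
    (hyw : G.Adj y w) (hwu : G.Adj w u) (hwx : w ≠ x) (hux : u ≠ x) (hx : deg G x = 2)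
    (hu : deg G u = 2) : False := by
  obtain ⟨c, h⟩ := hG.exists_isColoring x y hxy
  have hy := hG.deg_eq_four_of_deg_two hxy hx
  have huy : u ≠ y := by
    rintro rfl
    omega
  have hcx := h.card_missing_left hxy
  have hcy := h.card_missing_right hxy
  have hcu := h.card_missing_of_ne hux huy
  have hunc := h.card_uncovered hG hxy
  have hdis := Finset.disjoint_left.1 (h.disjoint_missing hG.not_isColoring hxy)
  obtain ⟨o, ho⟩ := Finset.card_eq_one.1 (by omega : (missing 4 c y).card = 1)
  have hoy : o ∈ missing 4 c y := by simp [ho]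
  have hxm : ∀ α < 4, α ≠ o → Misses c x α := by
    intro α hα hαo
    by_contra hcon
    have : α ∈ Finset.range 4 \ (missing 4 c x ∪ missing 4 c y) := by
      simp [mem_missing (v := x), hα, hcon, ho, hαo]
    have := Finset.card_pos.2 ⟨_, this⟩
    omega
  have hk : c y w < 4 := by
    rw [h.lt_iff, deleteEdges_adj']
    have := hxy.ne
    grind
  have hd : c w u < 4 := by
    rw [h.lt_iff, deleteEdges_adj']
    grind
  have hko : c y w ≠ o := (mem_missing.1 hoy).2 w
  have hdk : c w u ≠ c y w := fun hh => huy (h.inj w u y (hh.trans (h.symm _ _)) hd)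
  obtain ⟨e, he⟩ : ∃ e, (Finset.range 4 \ missing 4 c u).erase (c w u) = {e} := by
    rw [← Finset.card_eq_one, Finset.card_erase_of_mem,
      Finset.card_sdiff_of_subset missing_subset, Finset.card_range]
    · omega
    · simp only [Finset.mem_sdiff, Finset.mem_range, hd, true_and]
      exact fun hh => (mem_missing.1 hh).2 w (h.symm _ _)
  refine h.kierstead hG.not_isColoring hxy hux huy hwu.ne hk (mem_missing.1 hoy).1 hko hxm
    (mem_missing.1 hoy).2 rfl hd hdk rfl (e := e) fun α hα h1 h2 => ?_
  by_contra hcon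
  have : α ∈ (Finset.range 4 \ missing 4 c u).erase (c w u) := by
    simp [mem_missing, hα, hcon, h1]
  rw [he, Finset.mem_singleton] at this
  exact h2 this

end DegreeFour

section Bridge

variable {G H : SimpleGraph V} {n m : ℕ}

lemma IsColoring.mono {c : V → V → ℕ} (h : IsColoring H n c) (hnm : n ≤ m) :
    ∃ c', IsColoring H m c' := by
  have hs := h.symm
  have hl := h.lt_iff
  have hi := h.inj
  refine ⟨fun u v => if c u v < n then c u v else m, fun u v => ?_, fun u v => ?_,
    fun u v w => ?_⟩ <;> grind

open Classical in
lemma isColoring_of_isProperEdgeColoring {c : Sym2 V → ℕ} (h : IsProperEdgeColoring G n c) :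
    IsColoring G n fun u v => if G.Adj u v then c s(u, v) else n := by
  refine ⟨fun u v => ?_, fun u v => ?_, fun u v w huv hlt => ?_⟩
  · simp only [G.adj_comm u v, Sym2.eq_swap]
  · have := h.1 s(u, v)
    rw [SimpleGraph.mem_edgeSet] at this
    split_ifs with huv <;> simp_all
  · have hv : G.Adj u v := by
      by_contra hcon
      simp [hcon] at hlt
    have hw : G.Adj u w := by
      by_contra hcon
      rw [huv] at hlt
      simp [hcon] at hlt
    by_contra hvw
    rw [if_pos hv, if_pos hw] at huv
    refine h.2 s(u, v) hv s(u, w) hw (fun hh => hvw ?_) ⟨u, by simp, by simp⟩ huv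
    exact Sym2.congr_right.1 hh

lemma IsColoring.edgeChromaticNumber_le {c : V → V → ℕ} (h : IsColoring G n c) :
    edgeChromaticNumber G ≤ n := by
  refine Nat.sInf_le ⟨Sym2.lift ⟨c, h.symm⟩, ?_, ?_⟩
  · intro e
    induction e with | _ u v => exact (h.lt_iff u v).2
  · rintro e₁ he₁ e₂ he₂ hne ⟨v, hv₁, hv₂⟩ heq
    obtain ⟨a, rfl⟩ := Sym2.mem_iff_exists.1 hv₁
    obtain ⟨b, rfl⟩ := Sym2.mem_iff_exists.1 hv₂
    exact hne (by rw [h.inj v a b heq ((h.lt_iff v a).2 he₁)])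

lemma exists_isProperEdgeColoring [Finite V] (G : SimpleGraph V) :
    ∃ c, IsProperEdgeColoring G (edgeChromaticNumber G) c := by
  obtain ⟨k, ⟨f⟩⟩ := Finite.exists_equiv_fin (Sym2 V)
  exact Nat.sInf_mem (s := {n | ∃ c, IsProperEdgeColoring G n c})
    ⟨k, fun e => f e, fun e _ => (f e).2, fun e₁ _ e₂ _ hne _ heq =>
      hne (f.injective (Fin.ext heq))⟩

open Classical in
lemma IsColoring.spanningCoe {K : G.Subgraph} {c : K.verts → K.verts → ℕ}
    (h : IsColoring K.coe n c) :
    IsColoring K.spanningCoe n fun u v =>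
      if huv : K.Adj u v then c ⟨u, huv.fst_mem⟩ ⟨v, huv.snd_mem⟩ else n := by
  refine ⟨fun u v => ?_, fun u v => ?_, fun u v w huv hlt => ?_⟩
  · by_cases huv : K.Adj u v
    · rw [dif_pos huv, dif_pos huv.symm, h.symm]
    · rw [dif_neg huv, dif_neg fun hh => huv hh.symm]
  · rw [SimpleGraph.Subgraph.spanningCoe_adj]
    by_cases huv : K.Adj u v
    · rw [dif_pos huv, h.lt_iff, SimpleGraph.Subgraph.coe_adj]
    · simp [huv]
  · have hv : K.Adj u v := by
      by_contra hcon
      simp [hcon] at hlt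
    have hw : K.Adj u w := by
      by_contra hcon
      rw [huv] at hlt
      simp [hcon] at hlt
    rw [dif_pos hv] at hlt
    rw [dif_pos hv, dif_pos hw] at huv
    exact congrArg Subtype.val (h.inj _ _ _ huv hlt)

variable [Fintype V]

lemma exists_isColoring_spanningCoe (hG : IsCritical G) {K : G.Subgraph} (hK : K ≠ ⊤) :
    ∃ n < edgeChromaticNumber G, ∃ c, IsColoring K.spanningCoe n c := by
  obtain ⟨c, hc⟩ := exists_isProperEdgeColoring K.coe
  exact ⟨_, hG.2 K hK, _, (isColoring_of_isProperEdgeColoring hc).spanningCoe⟩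

lemma exists_isColoring_deleteEdges (hG : IsCritical G) {x y : V} (hxy : G.Adj x y) :
    ∃ n < edgeChromaticNumber G, ∃ c, IsColoring (G.deleteEdges {s(x, y)}) n c := by
  have hK : (⊤ : G.Subgraph).deleteEdges {s(x, y)} ≠ ⊤ := by
    intro hh
    have : ((⊤ : G.Subgraph).deleteEdges {s(x, y)}).Adj x y := by
      rw [hh]
      exact hxy
    simp at this
  have := exists_isColoring_spanningCoe hG hK
  have heq : ((⊤ : G.Subgraph).deleteEdges {s(x, y)}).spanningCoe = G.deleteEdges {s(x, y)} := by
    ext u v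
    simp
  rwa [heq] at this

lemma exists_adj_of_isCritical (hG : IsCritical G) (v : V) : ∃ w, G.Adj v w := by
  by_contra! hcon
  have hK : (⊤ : G.Subgraph).deleteVerts {v} ≠ ⊤ := by
    intro hh
    have : v ∈ ((⊤ : G.Subgraph).deleteVerts {v}).verts := by
      rw [hh]
      trivial
    simp at this
  obtain ⟨n, hn, c, hc⟩ := exists_isColoring_spanningCoe hG hK
  have heq : ((⊤ : G.Subgraph).deleteVerts {v}).spanningCoe = G := by
    ext a b
    have h1 := hcon a
    have h2 := hcon b
    have h3 := G.adj_comm a b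
    simp only [SimpleGraph.Subgraph.spanningCoe_adj, SimpleGraph.Subgraph.deleteVerts_adj,
      SimpleGraph.Subgraph.verts_top, SimpleGraph.Subgraph.top_adj, Set.mem_univ, true_and,
      Set.mem_singleton_iff]
    grind
  rw [heq] at hc
  exact absurd hc.edgeChromaticNumber_le (by omega)

lemma deg_le_maxDeg (G : SimpleGraph V) (v : V) : deg G v ≤ maxDeg G :=
  le_csSup (Set.finite_range (deg G)).bddAbove ⟨v, rfl⟩

lemma isCriticalFour_of_isKCritical (hG : IsKCritical G 4) : IsCriticalFour G := by
  obtain ⟨hcrit, hmax⟩ := hG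
  have hdeg : ∀ v, deg G v ≤ 4 := fun v => hmax ▸ deg_le_maxDeg G v
  have hχ : 5 ≤ edgeChromaticNumber G := by
    have hne : ({d | ∃ v, deg G v = d} : Set ℕ).Nonempty := by
      by_contra hcon
      rw [Set.not_nonempty_iff_eq_empty] at hcon
      rw [maxDeg, hcon] at hmax
      simp at hmax
    obtain ⟨v, hv⟩ : maxDeg G ∈ {d | ∃ v, deg G v = d} :=
      Nat.sSup_mem hne (Set.finite_range (deg G)).bddAbove
    obtain ⟨c, hc⟩ := exists_isProperEdgeColoring G
    have h1 := (isColoring_of_isProperEdgeColoring hc).card_missing v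
    have h2 := hcrit.1
    omega
  have hnot : ∀ m < edgeChromaticNumber G, ∀ c, ¬ IsColoring G m c :=
    fun m hm c hc => absurd hc.edgeChromaticNumber_le (by omega)
  refine ⟨hdeg, hnot 4 (by omega), fun x y hxy => ?_⟩
  obtain ⟨n, hn, c, hc⟩ := exists_isColoring_deleteEdges hcrit hxy
  rcases Nat.lt_or_ge 4 n with h5 | h5
  · exact (hc.false_of_five_le (hnot n hn) hxy h5 hdeg).elim
  · exact hc.mono h5

end Bridge

section Discharging

variable [Fintype V] {G : SimpleGraph V}

open Classical in
/-- The amount of charge sent from `u` to `v`. -/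
noncomputable def transfer (G : SimpleGraph V) (u v : V) : ℤ :=
  if G.Adj u v ∧ deg G u = 4 then
    if deg G v = 2 then 10
    else if deg G v = 3 then 3
    else if (∀ x, G.Adj u x → deg G x ≠ 2) ∧ ∃ x, G.Adj v x ∧ deg G x = 2 then 1 else 0
  else 0

lemma transfer_nonneg (u v : V) : 0 ≤ transfer G u v := by
  unfold transfer
  split_ifs <;> norm_num

lemma transfer_eq_zero_of_deg_ne {u : V} (hu : deg G u ≠ 4) (v : V) : transfer G u v = 0 :=
  if_neg fun h => hu h.2

lemma add_le_sum_transfer {a b v : V} (hab : a ≠ b) :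
    transfer G a v + transfer G b v ≤ ∑ u, transfer G u v := by
  classical
  rw [← Finset.sum_pair (f := fun u => transfer G u v) hab]
  exact Finset.sum_le_sum_of_subset_of_nonneg (Finset.subset_univ _)
    fun u _ _ => transfer_nonneg u v

open Classical in
lemma card_neighborFinset (G : SimpleGraph V) (v : V) : (G.neighborFinset v).card = deg G v := by
  rw [deg, ← Nat.card_coe_set_eq, Nat.card_eq_fintype_card,
    SimpleGraph.card_neighborSet_eq_degree, SimpleGraph.card_neighborFinset_eq_degree]

open Classical in
lemma sum_transfer_eq (v : V) :
    ∑ u, transfer G v u = ∑ u ∈ G.neighborFinset v, transfer G v u := by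
  refine (Finset.sum_subset (Finset.subset_univ _) fun u _ hu => if_neg fun h => hu ?_).symm
  simpa using h.1

lemma exists_adj_adj_of_deg {v : V} (hv : 2 ≤ deg G v) :
    ∃ a b, a ≠ b ∧ G.Adj v a ∧ G.Adj v b := by
  classical
  rw [← card_neighborFinset] at hv
  obtain ⟨a, ha, b, hb, hab⟩ := Finset.one_lt_card.1 hv
  exact ⟨a, b, hab, by simpa using ha, by simpa using hb⟩

lemma IsCriticalFour.two_le_deg (hG : IsCriticalFour G) {v w : V} (hvw : G.Adj v w) :
    2 ≤ deg G v := by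
  have := hG.six_le hvw
  have := hG.deg_le w
  omega

lemma IsCriticalFour.charge_deg_two (hG : IsCriticalFour G) {v : V} (hv : deg G v = 2) :
    20 ≤ ∑ u, transfer G u v := by
  obtain ⟨a, b, hab, ha, hb⟩ := exists_adj_adj_of_deg hv.ge
  have key : ∀ u, G.Adj v u → transfer G u v = 10 := fun u hu => by
    rw [transfer, if_pos ⟨hu.symm, hG.deg_eq_four_of_deg_two hu hv⟩, if_pos hv]
  have := add_le_sum_transfer (G := G) (v := v) hab
  rw [key a ha, key b hb] at this
  linarith

lemma IsCriticalFour.charge_deg_three (hG : IsCriticalFour G) {v : V} (hv : deg G v = 3) :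
    6 ≤ ∑ u, transfer G u v := by
  obtain ⟨a, b, hab, ha, hb, ha4, hb4⟩ :
      ∃ a b, a ≠ b ∧ G.Adj v a ∧ G.Adj v b ∧ deg G a = 4 ∧ deg G b = 4 := by
    by_cases h3 : ∃ x, G.Adj x v ∧ deg G x = 3
    · obtain ⟨x, hxv, hx⟩ := h3
      exact hG.exists_two_of_deg_three hxv hx
    · push Not at h3
      obtain ⟨a, b, hab, ha, hb⟩ := exists_adj_adj_of_deg (by omega : 2 ≤ deg G v)
      have key : ∀ u, G.Adj v u → deg G u = 4 := fun u hu => by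
        have := h3 u hu.symm
        have := hG.six_le hu
        have := hG.deg_le u
        omega
      exact ⟨a, b, hab, ha, hb, key a ha, key b hb⟩
  have key : ∀ u, G.Adj v u → deg G u = 4 → transfer G u v = 3 := fun u hu hu4 => by
    rw [transfer, if_pos ⟨hu.symm, hu4⟩, if_neg (by omega), if_pos hv]
  have := add_le_sum_transfer (G := G) (v := v) hab
  rw [key a ha ha4, key b hb hb4] at this
  linarith

lemma IsCriticalFour.charge_in_of_adj_deg_two (hG : IsCriticalFour G) {v x : V}
    (hvx : G.Adj v x) (hx : deg G x = 2) : 2 ≤ ∑ u, transfer G u v := by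
  classical
  have hv := hG.deg_eq_four_of_deg_two hvx.symm hx
  set N := (G.neighborFinset v).erase x with hN
  have hmem : ∀ u, u ∈ N ↔ u ≠ x ∧ G.Adj v u := by simp [hN]
  have hcard : N.card = 3 := by
    rw [hN, Finset.card_erase_of_mem (by simpa using hvx), card_neighborFinset, hv]
  have hS : (N.filter fun u => ∃ z, G.Adj u z ∧ deg G z = 2).card ≤ 1 := by
    have hsub : (N.filter fun u => ∃ z, G.Adj u z ∧ deg G z = 2) ⊆
        (G.neighborFinset x).erase v := by
      intro u hu
      rw [Finset.mem_filter, hmem] at hu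
      obtain ⟨⟨hux, hvu⟩, z, huz, hz⟩ := hu
      have hzx : z = x := by
        by_contra hcon
        exact hG.not_two_path_two hvx.symm hvu huz hux hcon hx hz
      rw [Finset.mem_erase, SimpleGraph.mem_neighborFinset]
      exact ⟨hvu.ne', hzx ▸ huz.symm⟩
    refine (Finset.card_le_card hsub).trans ?_
    rw [Finset.card_erase_of_mem (by simpa using hvx.symm), card_neighborFinset, hx]
  have hsum := Finset.card_filter_add_card_filter_not (s := N)
    (fun u => ∃ z, G.Adj u z ∧ deg G z = 2)
  obtain ⟨a, ha, b, hb, hab⟩ := Finset.one_lt_card.1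
    (by omega : 1 < (N.filter fun u => ¬ ∃ z, G.Adj u z ∧ deg G z = 2).card)
  have key : ∀ u ∈ N.filter fun u => ¬ ∃ z, G.Adj u z ∧ deg G z = 2, transfer G u v = 1 := by
    intro u hu
    rw [Finset.mem_filter, hmem] at hu
    obtain ⟨⟨hux, hvu⟩, hu2⟩ := hu
    push Not at hu2
    rw [transfer, if_pos ⟨hvu.symm, hG.deg_eq_four_of_two_path hvx.symm hx hvu hux⟩,
      if_neg (by omega), if_neg (by omega), if_pos ⟨hu2, x, hvx, hx⟩]
  have := add_le_sum_transfer (G := G) (v := v) hab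
  rw [key a ha, key b hb] at this
  linarith

lemma IsCriticalFour.charge_out_of_adj_deg_two (hG : IsCriticalFour G) {v x : V}
    (hvx : G.Adj v x) (hx : deg G x = 2) : ∑ u, transfer G v u = 10 := by
  have hv := hG.deg_eq_four_of_deg_two hvx.symm hx
  rw [Finset.sum_eq_single x]
  · rw [transfer, if_pos ⟨hvx, hv⟩, if_pos hx]
  · intro u _ hux
    by_cases hvu : G.Adj v u
    · have hu := hG.deg_eq_four_of_two_path hvx.symm hx hvu hux
      rw [transfer, if_pos ⟨hvu, hv⟩, if_neg (by omega), if_neg (by omega),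
        if_neg fun hh => hh.1 x hvx hx]
    · exact if_neg fun hh => hvu hh.1
  · simp

lemma IsCriticalFour.charge_out_of_forall_adj (hG : IsCriticalFour G) {v : V}
    (hv : deg G v = 4) (hS : ∀ x, G.Adj v x → deg G x ≠ 2) : ∑ u, transfer G v u ≤ 8 := by
  classical
  have hcard := card_neighborFinset G v
  rw [hv] at hcard
  rw [sum_transfer_eq]
  by_cases h3 : ∃ x, G.Adj x v ∧ deg G x = 3
  · obtain ⟨x, hxv, hx⟩ := h3
    obtain ⟨a, b, hab, ha, hb, ha4, hb4⟩ := hG.exists_two_of_deg_three hxv hx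
    have hsub : {a, b} ⊆ G.neighborFinset v := by
      simp [Finset.insert_subset_iff, ha, hb]
    rw [← Finset.sum_sdiff hsub, Finset.sum_pair hab]
    have h1 : ∑ u ∈ G.neighborFinset v \ {a, b}, transfer G v u ≤
        (G.neighborFinset v \ {a, b}).card • (3 : ℤ) := by
      refine Finset.sum_le_card_nsmul _ _ _ fun u hu => ?_
      rw [Finset.mem_sdiff, SimpleGraph.mem_neighborFinset] at hu
      have := hS u hu.1
      unfold transfer
      split_ifs <;> norm_num
    rw [Finset.card_sdiff_of_subset hsub, hcard, Finset.card_pair hab] at h1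
    have h2 : ∀ u, deg G u = 4 → transfer G v u ≤ 1 := by
      intro u hu
      unfold transfer
      split_ifs <;> omega
    have := h2 a ha4
    have := h2 b hb4
    norm_num at h1
    linarith
  · have h1 : ∑ u ∈ G.neighborFinset v, transfer G v u ≤
        (G.neighborFinset v).card • (1 : ℤ) := by
      refine Finset.sum_le_card_nsmul _ _ _ fun u hu => ?_
      rw [SimpleGraph.mem_neighborFinset] at hu
      have := hS u hu
      have : deg G u ≠ 3 := fun hh => h3 ⟨u, hu.symm, hh⟩
      unfold transfer
      split_ifs <;> norm_num
    rw [hcard] at h1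
    norm_num at h1
    linarith

lemma IsCriticalFour.charge_le (hG : IsCriticalFour G) {v w : V} (hvw : G.Adj v w) :
    48 + ∑ u, transfer G v u ≤ 14 * (deg G v : ℤ) + ∑ u, transfer G u v := by
  have h2 := hG.two_le_deg hvw
  have h4 := hG.deg_le v
  have hin : 0 ≤ ∑ u, transfer G u v := Finset.sum_nonneg fun u _ => transfer_nonneg u v
  have hout : deg G v ≠ 4 → ∑ u, transfer G v u = 0 := fun h =>
    Finset.sum_eq_zero fun u _ => transfer_eq_zero_of_deg_ne h u
  obtain hv | hv | hv : deg G v = 2 ∨ deg G v = 3 ∨ deg G v = 4 := by omega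
  · have := hG.charge_deg_two hv
    rw [hout (by omega), hv]
    push_cast
    linarith
  · have := hG.charge_deg_three hv
    rw [hout (by omega), hv]
    push_cast
    linarith
  · rw [hv]
    push_cast
    by_cases hS : ∃ x, G.Adj v x ∧ deg G x = 2
    · obtain ⟨x, hvx, hx⟩ := hS
      have := hG.charge_in_of_adj_deg_two hvx hx
      have := hG.charge_out_of_adj_deg_two hvx hx
      linarith
    · push Not at hS
      have := hG.charge_out_of_forall_adj hv hS
      linarith

lemma sum_deg (G : SimpleGraph V) : ∑ v, deg G v = 2 * G.edgeSet.ncard := by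
  classical
  have := G.sum_degrees_eq_twice_card_edges
  rw [← SimpleGraph.coe_edgeFinset, Set.ncard_coe_finset, ← this]
  exact Finset.sum_congr rfl fun v _ => (card_neighborFinset G v).symm

lemma IsCriticalFour.card_le (hG : IsCriticalFour G) (hadj : ∀ v, ∃ w, G.Adj v w) :
    12 * Fintype.card V ≤ 7 * G.edgeSet.ncard := by
  have h1 : ∑ v, (48 + ∑ u, transfer G v u) ≤
      ∑ v, (14 * (deg G v : ℤ) + ∑ u, transfer G u v) :=
    Finset.sum_le_sum fun v _ => hG.charge_le (hadj v).choose_spec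
  rw [Finset.sum_add_distrib, Finset.sum_add_distrib, ← Finset.mul_sum,
    Finset.sum_comm (f := fun v u => transfer G u v), add_le_add_iff_right, ← Nat.cast_sum,
    sum_deg] at h1
  simp only [Finset.sum_const, Finset.card_univ, nsmul_eq_mul] at h1
  push_cast at h1
  omega

end Discharging

end EdgeColoring

/-- If `G` is 4-critical, then `|E(G)| ≥ (12/7)·|V(G)|`. -/
theorem edge_bound_4critical [Fintype V] (G : SimpleGraph V)
    (hG : IsKCritical G 4) :
    (12 : ℚ) / 7 * Fintype.card V ≤ G.edgeSet.ncard := by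
  have h := (EdgeColoring.isCriticalFour_of_isKCritical hG).card_le
    (EdgeColoring.exists_adj_of_isCritical hG.1)
  have h' : (12 : ℚ) * Fintype.card V ≤ 7 * G.edgeSet.ncard := by exact_mod_cast h
  linarith
end

section
/- For every integer n ≥ 3, the graph G_n obtained from the prism over an n-cycle by subdividing one edge is 3-critical. Here the prism has vertices x_0, …, x_{n−1}, y_0, …, y_{n−1} with edges x_i x_{i+1}, y_i y_{i+1} (indices modulo n) and x_i y_i for all i, and G_n is obtained by replacing one edge, say x_0 x_1, by a new vertex u and the two edges x_0 u and u x_1. -/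
open SimpleGraph

variable {V : Type*}

/-- The generating relation of the subdivided prism `G_n`.
Vertices: `.inl i` is `x_i`, `.inr (.inl i)` is `y_i`, and `.inr (.inr ())`
is the subdivision vertex `u` (indices are taken modulo `n`, via `ZMod n`).
Edges: `x_i x_{i+1}` except for `x_0 x_1` (which is subdivided),
`y_i y_{i+1}`, `x_i y_i`, and `x_0 u`, `x_1 u`. -/
def prismSubRel (n : ℕ) : (ZMod n ⊕ ZMod n ⊕ Unit) → (ZMod n ⊕ ZMod n ⊕ Unit) → Prop
  | .inl i, .inl j => j = i + 1 ∧ ¬(i = 0 ∧ j = 1)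
  | .inr (.inl i), .inr (.inl j) => j = i + 1
  | .inl i, .inr (.inl j) => j = i
  | .inl i, .inr (.inr _) => i = 0 ∨ i = 1
  | _, _ => False

/-- `G_n`: the prism over an `n`-cycle with the edge `x_0 x_1` subdivided. -/
def prismSub (n : ℕ) : SimpleGraph (ZMod n ⊕ ZMod n ⊕ Unit) :=
  SimpleGraph.fromRel (prismSubRel n)

/-! ### Edge colorings of a ladder with a missing edge -/

/-- A 3-coloring of (part of) the ladder with outer edges `0, …, n`, inner edges `0, …, n` and
rungs `0, …, n - 1`, where rung `j` sits between the edges `j` and `j + 1`. The predicates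
`pa`, `pb`, `pr` say which edges are present. Inner edges `0` and `n` are identified and outer
edges `0` and `n` share an endpoint. -/
structure IsLadderColoring (n : ℕ) (pa pb pr : ℕ → Prop) (A B R : ℕ → ℕ) : Prop where
  outer_lt : ∀ j ≤ n, A j < 3
  inner_lt : ∀ j ≤ n, B j < 3
  rung_lt : ∀ j < n, R j < 3
  outer_ne : ∀ j < n, pa j → pa (j + 1) → A j ≠ A (j + 1)
  inner_ne : ∀ j < n, pb j → pb (j + 1) → B j ≠ B (j + 1)
  outer_rung : ∀ j < n, pa j → pr j → A j ≠ R j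
  outer_rung' : ∀ j < n, pa (j + 1) → pr j → A (j + 1) ≠ R j
  inner_rung : ∀ j < n, pb j → pr j → B j ≠ R j
  inner_rung' : ∀ j < n, pb (j + 1) → pr j → B (j + 1) ≠ R j
  inner_closed : B 0 = B n
  outer_closed : pa 0 → pa n → A 0 ≠ A n

theorem exists_ladderColoring_of_outer {n : ℕ} (hn : 3 ≤ n) {pa : ℕ → Prop} (pb pr : ℕ → Prop)
    {i : ℕ} (hi : i ≤ n) (h : ¬ pa i) : ∃ A B R, IsLadderColoring n pa pb pr A B R := by
  have hp : ∀ j, pa j → j ≠ i := by rintro j hj rfl; exact h hj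
  by_cases h0 : i = 0 ∨ i = n
  · let c : ℕ → ℕ := fun j => if j = 0 ∨ j = n then 0 else if j % 2 = 1 then 2 else 1
    refine ⟨c, c, fun j => 3 - c j - c (j + 1), ?_⟩
    constructor <;> simp only [c] <;> grind
  by_cases h1 : i = n - 1
  · let c : ℕ → ℕ := fun j => if j = 0 ∨ j = n then 0 else if j % 2 = 1 then 2 else 1
    refine ⟨fun j => if j = n then c (n - 1) else c j, c, fun j => 3 - c j - c (j + 1), ?_⟩
    constructor <;> simp only [c] <;> grind
  · let A : ℕ → ℕ := fun j => if j ≤ i then (if j % 2 = 0 then 1 else 0) else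
      if j = n then 0 else if (j - i) % 2 = 1 then 2 else 1
    let B : ℕ → ℕ := fun j => if j ≤ i then (if j % 2 = 0 then 0 else 1) else
      if j = n then 0 else if (j - i) % 2 = 1 then 2 else 1
    refine ⟨A, B, fun j => if j < i then 2 else 3 - B j - B (j + 1), ?_⟩
    constructor <;> simp only [A, B] <;> grind

theorem exists_ladderColoring_of_inner {n : ℕ} (hn : 3 ≤ n) (pa : ℕ → Prop) {pb : ℕ → Prop}
    (pr : ℕ → Prop) (hb : pb n → pb 0) {i : ℕ} (hi : i < n) (h : ¬ pb i) :
    ∃ A B R, IsLadderColoring n pa pb pr A B R := by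
  have hp : ∀ j, pb j → j ≠ i := by rintro j hj rfl; exact h hj
  by_cases h0 : i = 0
  · let A : ℕ → ℕ := fun j => if j = 0 then 1 else if j = n then 0 else
      if j % 2 = 1 then 2 else 1
    refine ⟨A, fun j => if j = 0 then 0 else A j, fun j => 3 - A j - A (j + 1), ?_⟩
    have hpn : ¬ pb n := fun hn => hp 0 (hb hn) h0.symm
    have hp' : ∀ j, pb j → j ≠ n := by rintro j hj rfl; exact hpn hj
    constructor <;> simp only [A] <;> grind
  by_cases h1 : i = n - 1 ∧ i % 2 = 1
  · refine ⟨fun j => if j = n then 2 else if j % 2 = 0 then 1 else 0,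
      fun j => if j % 2 = 0 then 0 else 1, fun j => if j = n - 1 then 1 else 2, ?_⟩
    constructor <;> grind
  · let A : ℕ → ℕ := fun j => if j ≤ i then (if j % 2 = 0 then 1 else 0) else
      if j = n then 0 else if (j - i) % 2 = 1 then 2 else 1
    let B : ℕ → ℕ := fun j => if j ≤ i then (if j % 2 = 0 then 0 else 1) else
      if j = n then 0 else if (j - i) % 2 = 1 then 2 else 1
    refine ⟨A, B, fun j => if j < i then 2 else 3 - A j - A (j + 1), ?_⟩
    constructor <;> simp only [A, B] <;> grind

theorem exists_ladderColoring_of_rung {n : ℕ} (hn : 3 ≤ n) (pa pb : ℕ → Prop) {pr : ℕ → Prop}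
    {i : ℕ} (hi : i < n) (h : ¬ pr i) : ∃ A B R, IsLadderColoring n pa pb pr A B R := by
  have hp : ∀ j, pr j → j ≠ i := by rintro j hj rfl; exact h hj
  by_cases h1 : i = n - 1
  · let c : ℕ → ℕ := fun j => if j = 0 ∨ j = n then 0 else if j % 2 = 1 then 2 else 1
    refine ⟨fun j => if j = n then 3 - c (n - 1) else c j, c, fun j => 3 - c j - c (j + 1), ?_⟩
    constructor <;> simp only [c] <;> grind
  · let A : ℕ → ℕ := fun j => if j ≤ i then (if j % 2 = 0 then 1 else 0) else
      if j = n then 0 else if (j - i) % 2 = 1 then 2 else 1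
    let B : ℕ → ℕ := fun j => if j ≤ i then (if j % 2 = 0 then 0 else 1) else
      if j = n then 0 else if (j - i) % 2 = 1 then 2 else 1
    refine ⟨A, B, fun j => if j ≤ i then 2 else 3 - A j - A (j + 1), ?_⟩
    constructor <;> simp only [A, B] <;> grind

/-! ### General facts on edge colorings -/

theorem IsProperEdgeColoring.mono {G : SimpleGraph V} {m n : ℕ} {c : Sym2 V → ℕ}
    (hc : IsProperEdgeColoring G m c) (h : m ≤ n) : IsProperEdgeColoring G n c :=
  ⟨fun e he => (hc.1 e he).trans_le h, hc.2⟩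

theorem exists_isProperEdgeColoring [Finite V] (G : SimpleGraph V) :
    ∃ n c, IsProperEdgeColoring G n c := by
  obtain ⟨n, ⟨e⟩⟩ := Finite.exists_equiv_fin (Sym2 V)
  exact ⟨n, fun x => e x, fun x _ => (e x).2,
    fun x _ y _ hxy _ h => hxy (e.injective (Fin.ext h))⟩

theorem lt_edgeChromaticNumber [Finite V] {G : SimpleGraph V} {n : ℕ}
    (h : ∀ c, ¬ IsProperEdgeColoring G n c) : n < edgeChromaticNumber G := by
  by_contra! hle
  obtain ⟨c, hc⟩ := Nat.sInf_mem (s := {n | ∃ c, IsProperEdgeColoring G n c})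
    (exists_isProperEdgeColoring G)
  exact h c (hc.mono hle)

/-- A subgraph can be edge colored through a function on ordered pairs of vertices. -/
theorem edgeChromaticNumber_coe_le {G : SimpleGraph V} (H : G.Subgraph) {n : ℕ}
    (f : V → V → ℕ) (hlt : ∀ v w, H.Adj v w → f v w < n)
    (hsymm : ∀ v w, H.Adj v w → f v w = f w v)
    (hinj : ∀ v w w', H.Adj v w → H.Adj v w' → f v w = f v w' → w = w') :
    edgeChromaticNumber H.coe ≤ n := by
  refine Nat.sInf_le ⟨fun e => f e.out.1 e.out.2, ?_⟩
  have key : ∀ v w : H.verts, H.Adj v w → f (s(v, w)).out.1 (s(v, w)).out.2 = f v w := by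
    intro v w hvw
    have h : s((s(v, w)).out.1, (s(v, w)).out.2) = s(v, w) := Quot.out_eq _
    rcases Sym2.eq_iff.1 h with ⟨h1, h2⟩ | ⟨h1, h2⟩
    · rw [h1, h2]
    · rw [h1, h2, hsymm _ _ hvw]
  constructor
  · intro e
    induction e with | _ v w =>
    intro he
    have he : H.Adj v w := he
    simpa only [key v w he] using hlt _ _ he
  · rintro e₁ h₁ e₂ h₂ hne ⟨v, ⟨w, rfl⟩, ⟨w', rfl⟩⟩ heq
    have h₁ : H.Adj v w := h₁
    have h₂ : H.Adj v w' := h₂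
    simp only [key v w h₁, key v w' h₂] at heq
    exact hne (by rw [Subtype.ext (hinj _ _ _ h₁ h₂ heq)])

/-- A graph with an odd number of vertices, all of degree 3 except for one non-isolated vertex,
is not 3-edge-colorable. -/
theorem not_isProperEdgeColoring_three [Fintype V] {G : SimpleGraph V} (u w : V)
    (huw : G.Adj u w) (hodd : Odd (Fintype.card V))
    (hdeg : ∀ v ≠ u, ∃ a b d, a ≠ b ∧ a ≠ d ∧ b ≠ d ∧ G.Adj v a ∧ G.Adj v b ∧ G.Adj v d)
    (c : Sym2 V → ℕ) : ¬ IsProperEdgeColoring G 3 c := by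
  intro hc
  have hinj : ∀ v a b, G.Adj v a → G.Adj v b → a ≠ b → c s(v, a) ≠ c s(v, b) := by
    intro v a b ha hb hab
    refine hc.2 _ ha _ hb (fun h => hab (Sym2.congr_right.1 h)) ⟨v, Sym2.mem_mk_left _ _, Sym2.mem_mk_left _ _⟩
  let M : G.Subgraph :=
    { verts := Set.univ
      Adj := fun a b => G.Adj a b ∧ c s(a, b) = c s(u, w)
      adj_sub := fun h => h.1
      edge_vert := fun _ => trivial
      symm := ⟨fun a b h => ⟨h.1.symm, by rw [Sym2.eq_swap]; exact h.2⟩⟩ }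
  have hM : M.IsPerfectMatching := by
    rw [Subgraph.isPerfectMatching_iff]
    intro v
    refine existsUnique_of_exists_of_unique ?_ ?_
    · by_cases hv : v = u
      · subst hv; exact ⟨w, huw, rfl⟩
      · obtain ⟨a, b, d, hab, had, hbd, ha, hb, hd⟩ := hdeg v hv
        have h1 := hinj v a b ha hb hab
        have h2 := hinj v a d ha hd had
        have h3 := hinj v b d hb hd hbd
        have h4 := hc.1 s(v, a) ha
        have h5 := hc.1 s(v, b) hb
        have h6 := hc.1 s(v, d) hd
        have h7 := hc.1 s(u, w) huw
        have : c s(v, a) = c s(u, w) ∨ c s(v, b) = c s(u, w) ∨ c s(v, d) = c s(u, w) := by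
          omega
        rcases this with h | h | h
        exacts [⟨a, ha, h⟩, ⟨b, hb, h⟩, ⟨d, hd, h⟩]
    · intro a b ha hb
      by_contra hab
      exact hinj v a b ha.1 hb.1 hab (ha.2.trans hb.2.symm)
  exact (Nat.not_even_iff_odd.2 hodd) hM.even_card

/-! ### The subdivided prism -/

namespace PrismSub

/-- The outer vertex `x_i`. -/
abbrev x {n : ℕ} (i : ZMod n) : ZMod n ⊕ ZMod n ⊕ Unit := .inl i

/-- The inner vertex `y_i`. -/
abbrev y {n : ℕ} (i : ZMod n) : ZMod n ⊕ ZMod n ⊕ Unit := .inr (.inl i)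

/-- The subdivision vertex `u`. -/
abbrev u {n : ℕ} : ZMod n ⊕ ZMod n ⊕ Unit := .inr (.inr ())

/-- The predecessor of `x_i` on the outer cycle. -/
def prev {n : ℕ} (i : ZMod n) : ZMod n ⊕ ZMod n ⊕ Unit := if i = 1 then u else x (i - 1)

/-- The successor of `x_i` on the outer cycle. -/
def next {n : ℕ} (i : ZMod n) : ZMod n ⊕ ZMod n ⊕ Unit := if i = 0 then u else x (i + 1)

/-- The position of column `i` when counting starts after the subdivided edge. -/
def pos {n : ℕ} (i : ZMod n) : ℕ := (i - 1).val

/-- The edge coloring of the subdivided prism induced by a coloring of the ladder. -/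
def color {n : ℕ} (A B R : ℕ → ℕ) :
    (ZMod n ⊕ ZMod n ⊕ Unit) → (ZMod n ⊕ ZMod n ⊕ Unit) → ℕ
  | .inl i, .inl j => if j = i + 1 then A (pos i + 1) else A (pos i)
  | .inl i, .inr (.inl _) => R (pos i)
  | .inl i, .inr (.inr _) => if i = 1 then A 0 else A n
  | .inr (.inl i), .inl _ => R (pos i)
  | .inr (.inl i), .inr (.inl j) => if j = i + 1 then B (pos i + 1) else B (pos i)
  | .inr (.inr _), .inl i => if i = 1 then A 0 else A n
  | _, _ => 0

section

variable {n : ℕ}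

theorem one_ne_zero' (hn : 3 ≤ n) : (1 : ZMod n) ≠ 0 := by
  have : Fact (1 < n) := ⟨by omega⟩
  exact one_ne_zero

theorem two_ne_zero' (hn : 3 ≤ n) : (1 + 1 : ZMod n) ≠ 0 := by
  intro h
  have h2 : ((2 : ℕ) : ZMod n) = 0 := by push_cast; rw [← h]; norm_num
  have := Nat.le_of_dvd (by omega) ((ZMod.natCast_eq_zero_iff 2 n).1 h2)
  omega

theorem pos_lt (hn : 3 ≤ n) (i : ZMod n) : pos i < n := by
  have : NeZero n := ⟨by omega⟩
  exact ZMod.val_lt _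

theorem cast_pos (hn : 3 ≤ n) (i : ZMod n) : (pos i : ZMod n) = i - 1 := by
  have : NeZero n := ⟨by omega⟩
  simp [pos]

theorem pos_zero (hn : 3 ≤ n) : pos (0 : ZMod n) + 1 = n := by
  obtain ⟨m, rfl⟩ : ∃ m, n = m + 1 := ⟨n - 1, by omega⟩
  simp [pos, ZMod.val_neg_one]

theorem pos_one : pos (1 : ZMod n) = 0 := by simp [pos]

theorem pos_add_one (hn : 3 ≤ n) {i : ZMod n} (hi : i ≠ 0) : pos (i + 1) = pos i + 1 := by
  have hlt := pos_lt hn i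
  have hlt' := pos_lt hn (i + 1)
  have hne : pos i + 1 ≠ n := by
    intro h
    apply hi
    have h2 : ((pos i + 1 : ℕ) : ZMod n) = 0 := by rw [h]; simp
    push_cast at h2
    rw [cast_pos hn] at h2
    simpa using h2
  have h : ((pos (i + 1) : ℕ) : ZMod n) = ((pos i + 1 : ℕ) : ZMod n) := by
    push_cast
    rw [cast_pos hn, cast_pos hn]
    ring
  rw [ZMod.natCast_eq_natCast_iff'] at h
  rwa [Nat.mod_eq_of_lt hlt', Nat.mod_eq_of_lt (by omega)] at h

theorem sub_one_ne_add_one (hn : 3 ≤ n) (i : ZMod n) : i - 1 ≠ i + 1 := by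
  exact fun h => two_ne_zero' hn (by linear_combination -h)

theorem adj_x (hn : 3 ≤ n) (i : ZMod n) (w) :
    (prismSub n).Adj (x i) w ↔ w = y i ∨ w = prev i ∨ w = next i := by
  have h1 := one_ne_zero' hn
  have h2 := two_ne_zero' hn
  rcases w with j | j | j <;>
    simp only [prismSub, SimpleGraph.fromRel_adj, prismSubRel, prev, next] <;> grind

theorem adj_y (hn : 3 ≤ n) (i : ZMod n) (w) :
    (prismSub n).Adj (y i) w ↔ w = x i ∨ w = y (i - 1) ∨ w = y (i + 1) := by
  have h1 := one_ne_zero' hn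
  have h2 := two_ne_zero' hn
  rcases w with j | j | j <;>
    simp only [prismSub, SimpleGraph.fromRel_adj, prismSubRel] <;> grind

theorem adj_u (w) : (prismSub n).Adj u w ↔ w = x 0 ∨ w = x 1 := by
  rcases w with j | j | j <;>
    simp only [prismSub, SimpleGraph.fromRel_adj, prismSubRel] <;> grind

theorem prev_ne_next (hn : 3 ≤ n) (i : ZMod n) : prev i ≠ next i := by
  have h1 := one_ne_zero' hn
  have h2 := sub_one_ne_add_one hn i
  simp only [prev, next]
  grind

theorem y_ne_prev (i : ZMod n) : y i ≠ prev i := by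
  simp only [prev]; grind

theorem y_ne_next (i : ZMod n) : y i ≠ next i := by
  simp only [next]; grind

theorem exists_three_neighbors (hn : 3 ≤ n) (v : ZMod n ⊕ ZMod n ⊕ Unit) (hv : v ≠ u) :
    ∃ a b d, a ≠ b ∧ a ≠ d ∧ b ≠ d ∧ ∀ w, (prismSub n).Adj v w ↔ w = a ∨ w = b ∨ w = d := by
  rcases v with i | i | i
  · exact ⟨_, _, _, y_ne_prev i, y_ne_next i, prev_ne_next hn i, adj_x hn i⟩
  · exact ⟨_, _, _, by simp, by simp, by simpa using sub_one_ne_add_one hn i, adj_y hn i⟩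
  · exact absurd rfl hv

theorem deg_eq_three (hn : 3 ≤ n) (v : ZMod n ⊕ ZMod n ⊕ Unit) (hv : v ≠ u) :
    deg (prismSub n) v = 3 := by
  obtain ⟨a, b, d, hab, had, hbd, h⟩ := exists_three_neighbors hn v hv
  exact Set.ncard_eq_three.2 ⟨a, b, d, hab, had, hbd, Set.ext h⟩

theorem deg_u_le : deg (prismSub n) u ≤ 3 := by
  have h : (prismSub n).neighborSet u = {x 0, x 1} := Set.ext adj_u
  rw [deg, h]
  exact (Set.ncard_insert_le _ _).trans (by simp)

theorem maxDeg_eq_three (hn : 3 ≤ n) : maxDeg (prismSub n) = 3 := by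
  refine IsGreatest.csSup_eq ⟨⟨x 0, deg_eq_three hn _ (by simp)⟩, ?_⟩
  rintro d ⟨v, rfl⟩
  by_cases hv : v = u
  · subst hv; exact deg_u_le
  · exact (deg_eq_three hn v hv).le

theorem three_lt_edgeChromaticNumber (hn : 3 ≤ n) : 3 < edgeChromaticNumber (prismSub n) := by
  have : NeZero n := ⟨by omega⟩
  refine lt_edgeChromaticNumber (not_isProperEdgeColoring_three u (x 0)
    ((adj_u _).2 (.inl rfl)) ?_ ?_)
  · simp only [Fintype.card_sum, ZMod.card, Fintype.card_unit]
    exact ⟨n, by ring⟩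
  · intro v hv
    obtain ⟨a, b, d, hab, had, hbd, h⟩ := exists_three_neighbors hn v hv
    exact ⟨a, b, d, hab, had, hbd, (h a).2 (by simp), (h b).2 (by simp), (h d).2 (by simp)⟩

variable (H : (prismSub n).Subgraph)

/-- The presence in `H` of the `j`-th outer edge. -/
def HasOuter (j : ℕ) : Prop :=
  if j = 0 then H.Adj u (x 1) else if j = n then H.Adj (x 0) u else H.Adj (x j) (x (j + 1))

/-- The presence in `H` of the `j`-th inner edge. -/
def HasInner (j : ℕ) : Prop := H.Adj (y j) (y (j + 1))

/-- The presence in `H` of the `j`-th rung. -/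
def HasRung (j : ℕ) : Prop := H.Adj (x (j + 1)) (y (j + 1))

theorem hasRung_pos (hn : 3 ≤ n) (i : ZMod n) : HasRung H (pos i) ↔ H.Adj (x i) (y i) := by
  simp [HasRung, cast_pos hn]

theorem hasInner_pos (hn : 3 ≤ n) (i : ZMod n) :
    HasInner H (pos i) ↔ H.Adj (y i) (y (i - 1)) := by
  simp [HasInner, cast_pos hn, H.adj_comm]

theorem hasInner_pos_add_one (hn : 3 ≤ n) (i : ZMod n) :
    HasInner H (pos i + 1) ↔ H.Adj (y i) (y (i + 1)) := by
  simp [HasInner, cast_pos hn]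

theorem pos_eq_zero (hn : 3 ≤ n) {i : ZMod n} : pos i = 0 ↔ i = 1 := by
  have : NeZero n := ⟨by omega⟩
  rw [pos, ZMod.val_eq_zero, sub_eq_zero]

theorem pos_add_one_eq (hn : 3 ≤ n) {i : ZMod n} : pos i + 1 = n ↔ i = 0 := by
  refine ⟨fun h => ?_, fun h => h ▸ pos_zero hn⟩
  by_contra hi
  have := pos_lt hn (i + 1)
  rw [pos_add_one hn hi] at this
  omega

theorem hasOuter_pos (hn : 3 ≤ n) (i : ZMod n) :
    HasOuter H (pos i) ↔ H.Adj (x i) (prev i) := by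
  have hlt := pos_lt hn i
  by_cases hi : i = 1
  · subst hi
    simp [HasOuter, prev, pos_one, H.adj_comm]
  · have h0 : pos i ≠ 0 := fun h => hi ((pos_eq_zero hn).1 h)
    simp [HasOuter, prev, hi, h0, hlt.ne, cast_pos hn, H.adj_comm]

theorem hasOuter_pos_add_one (hn : 3 ≤ n) (i : ZMod n) :
    HasOuter H (pos i + 1) ↔ H.Adj (x i) (next i) := by
  by_cases hi : i = 0
  · subst hi
    have : n ≠ 0 := by omega
    simp [HasOuter, next, pos_zero hn, this]
  · have h0 : pos i + 1 ≠ n := fun h => hi ((pos_add_one_eq hn).1 h)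
    simp [HasOuter, next, hi, h0, cast_pos hn]

variable (A B R : ℕ → ℕ)

theorem color_prev (hn : 3 ≤ n) (i : ZMod n) : color A B R (x i) (prev i) = A (pos i) := by
  have h := sub_one_ne_add_one hn i
  by_cases hi : i = 1
  · subst hi; simp [prev, color, pos_one]
  · simp [prev, color, hi, h]

theorem color_next (hn : 3 ≤ n) (i : ZMod n) : color A B R (x i) (next i) = A (pos i + 1) := by
  by_cases hi : i = 0
  · subst hi; simp [next, color, pos_zero hn, (one_ne_zero' hn).symm]
  · simp [next, color, hi]

theorem color_y_sub_one (hn : 3 ≤ n) (i : ZMod n) :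
    color A B R (y i) (y (i - 1)) = B (pos i) := by
  simp [color, sub_one_ne_add_one hn i]

theorem color_y_add_one (i : ZMod n) : color A B R (y i) (y (i + 1)) = B (pos i + 1) := by
  simp [color]

theorem color_symm (hn : 3 ≤ n) (hB : B 0 = B n) {v w : ZMod n ⊕ ZMod n ⊕ Unit}
    (h : (prismSub n).Adj v w) : color A B R v w = color A B R w v := by
  have hX : ∀ i : ZMod n, i ≠ 0 →
      color A B R (x i) (x (i + 1)) = color A B R (x (i + 1)) (x i) := by
    intro i hi
    have h := sub_one_ne_add_one hn (i + 1)
    rw [add_sub_cancel_right] at h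
    simp only [color, h, if_true, if_false, pos_add_one hn hi]
  have hY : ∀ i : ZMod n, color A B R (y i) (y (i + 1)) = color A B R (y (i + 1)) (y i) := by
    intro i
    have h := sub_one_ne_add_one hn (i + 1)
    rw [add_sub_cancel_right] at h
    simp only [color, h, if_true, if_false]
    by_cases hi : i = 0
    · subst hi
      rw [pos_zero hn, zero_add, pos_one, hB]
    · rw [pos_add_one hn hi]
  have hrel : ∀ v w : ZMod n ⊕ ZMod n ⊕ Unit, prismSubRel n v w →
      color A B R v w = color A B R w v := by
    rintro (i | i | i) (j | j | j) h <;> simp only [prismSubRel] at h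
    · obtain ⟨rfl, h⟩ := h
      exact hX i (fun hi => h ⟨hi, by rw [hi, zero_add]⟩)
    · subst h; rfl
    · rfl
    · subst h; exact hY i
  rw [prismSub, SimpleGraph.fromRel_adj] at h
  exact h.2.elim (hrel v w) (fun h => (hrel w v h).symm)

theorem edgeChromaticNumber_coe_le_three (hn : 3 ≤ n) {A B R : ℕ → ℕ}
    (h : IsLadderColoring n (HasOuter H) (HasInner H) (HasRung H) A B R) :
    edgeChromaticNumber H.coe ≤ 3 := by
  have hsymm : ∀ v w, H.Adj v w → color A B R v w = color A B R w v :=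
    fun v w hvw => color_symm A B R hn h.inner_closed hvw.adj_sub
  have hn0 : n ≠ 0 := by omega
  have hcr : ∀ i : ZMod n, color A B R (x i) (y i) = R (pos i) := fun _ => rfl
  have hcr' : ∀ i : ZMod n, color A B R (y i) (x i) = R (pos i) := fun _ => rfl
  have hu0 : color A B R u (x (0 : ZMod n)) = A n := by
    simp [color, (one_ne_zero' hn).symm]
  have hu1 : color A B R u (x (1 : ZMod n)) = A 0 := by simp [color]
  refine edgeChromaticNumber_coe_le H (color A B R) ?_ hsymm ?_
  · rintro (i | i | i) w hw
    · have hlt := pos_lt hn i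
      rcases (adj_x hn i w).1 hw.adj_sub with rfl | rfl | rfl
      · exact h.rung_lt _ hlt
      · rw [color_prev A B R hn]; exact h.outer_lt _ hlt.le
      · rw [color_next A B R hn]; exact h.outer_lt _ hlt
    · have hlt := pos_lt hn i
      rcases (adj_y hn i w).1 hw.adj_sub with rfl | rfl | rfl
      · exact h.rung_lt _ hlt
      · rw [color_y_sub_one A B R hn]; exact h.inner_lt _ hlt.le
      · rw [color_y_add_one A B R]; exact h.inner_lt _ hlt
    · rcases (adj_u w).1 hw.adj_sub with rfl | rfl
      · rw [hu0]; exact h.outer_lt _ le_rfl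
      · rw [hu1]; exact h.outer_lt _ n.zero_le
  · rintro (i | i | i) w w' hw hw' heq
    · have hlt := pos_lt hn i
      have h1 := h.outer_ne _ hlt
      have h2 := h.outer_rung _ hlt
      have h3 := h.outer_rung' _ hlt
      rw [hasOuter_pos H hn, hasOuter_pos_add_one H hn] at h1
      rw [hasOuter_pos H hn, hasRung_pos H hn] at h2
      rw [hasOuter_pos_add_one H hn, hasRung_pos H hn] at h3
      have hp := color_prev A B R hn i
      have hq := color_next A B R hn i
      have hr := hcr i
      rcases (adj_x hn i w).1 hw.adj_sub with rfl | rfl | rfl <;>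
      rcases (adj_x hn i w').1 hw'.adj_sub with rfl | rfl | rfl <;> grind
    · have hlt := pos_lt hn i
      have h1 := h.inner_ne _ hlt
      have h2 := h.inner_rung _ hlt
      have h3 := h.inner_rung' _ hlt
      rw [hasInner_pos H hn, hasInner_pos_add_one H hn] at h1
      rw [hasInner_pos H hn, hasRung_pos H hn, H.adj_comm (x i)] at h2
      rw [hasInner_pos_add_one H hn, hasRung_pos H hn, H.adj_comm (x i)] at h3
      have hp := color_y_sub_one A B R hn i
      have hq := color_y_add_one A B R i
      have hr := hcr' i
      rcases (adj_y hn i w).1 hw.adj_sub with rfl | rfl | rfl <;>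
      rcases (adj_y hn i w').1 hw'.adj_sub with rfl | rfl | rfl <;> grind
    · have h1 := h.outer_closed
      simp only [HasOuter, hn0, if_true, if_false, H.adj_comm (x 0)] at h1
      rcases (adj_u w).1 hw.adj_sub with rfl | rfl <;>
      rcases (adj_u w').1 hw'.adj_sub with rfl | rfl <;> grind

variable {H}

theorem exists_adj_of_ne_top (hn : 3 ≤ n) (hH : H ≠ ⊤) :
    ∃ v w, (prismSub n).Adj v w ∧ ¬ H.Adj v w := by
  by_contra! hcon
  refine hH (top_le_iff.1 ⟨fun v _ => ?_, fun v w h => hcon v w h⟩)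
  by_cases hv : v = u
  · subst hv
    exact (hcon _ _ ((adj_u _).2 (.inl rfl))).fst_mem
  · obtain ⟨a, b, d, -, -, -, h⟩ := exists_three_neighbors hn v hv
    exact (hcon _ _ ((h a).2 (.inl rfl))).fst_mem

theorem exists_ladderColoring (hn : 3 ≤ n) (hH : H ≠ ⊤) :
    ∃ A B R, IsLadderColoring n (HasOuter H) (HasInner H) (HasRung H) A B R := by
  obtain ⟨v, w, hG, hvw⟩ := exists_adj_of_ne_top hn hH
  have rung : ∀ i : ZMod n, ¬ H.Adj (x i) (y i) →
      ∃ A B R, IsLadderColoring n (HasOuter H) (HasInner H) (HasRung H) A B R := fun i hi =>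
    exists_ladderColoring_of_rung hn _ _ (pos_lt hn i) (by rwa [hasRung_pos H hn])
  have inner : ∀ i : ZMod n, ¬ H.Adj (y i) (y (i - 1)) →
      ∃ A B R, IsLadderColoring n (HasOuter H) (HasInner H) (HasRung H) A B R := fun i hi =>
    exists_ladderColoring_of_inner hn _ _ (by simp [HasInner]) (pos_lt hn i)
      (by rwa [hasInner_pos H hn])
  have outer : ∀ j ≤ n, ¬ HasOuter H j →
      ∃ A B R, IsLadderColoring n (HasOuter H) (HasInner H) (HasRung H) A B R := fun j hj h =>
    exists_ladderColoring_of_outer hn _ _ hj h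
  rcases v with i | i | i
  · rcases (adj_x hn i w).1 hG with rfl | rfl | rfl
    · exact rung i hvw
    · exact outer _ (pos_lt hn i).le (by rwa [hasOuter_pos H hn])
    · exact outer _ (pos_lt hn i) (by rwa [hasOuter_pos_add_one H hn])
  · rcases (adj_y hn i w).1 hG with rfl | rfl | rfl
    · exact rung i (by rwa [H.adj_comm])
    · exact inner i hvw
    · exact inner (i + 1) (by rwa [add_sub_cancel_right, H.adj_comm])
  · rcases (adj_u w).1 hG with rfl | rfl
    · refine outer n le_rfl ?_
      have : n ≠ 0 := by omega
      simpa [HasOuter, this, H.adj_comm] using hvw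
    · exact outer 0 n.zero_le (by simpa [HasOuter] using hvw)

end

end PrismSub

/-- For every `n ≥ 3`, the graph obtained from the prism over an `n`-cycle by
subdividing one edge is 3-critical. -/
theorem prismSub_three_critical (n : ℕ) (hn : 3 ≤ n) :
    IsKCritical (prismSub n) 3 := by
  have hlt := PrismSub.three_lt_edgeChromaticNumber hn
  have hmax := PrismSub.maxDeg_eq_three hn
  refine ⟨⟨by omega, fun H hH => ?_⟩, hmax⟩
  obtain ⟨A, B, R, h⟩ := PrismSub.exists_ladderColoring hn hH
  exact (PrismSub.edgeChromaticNumber_coe_le_three H hn h).trans_lt hlt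
end

section
/- For every integer n ≥ 3, the graph H_n obtained from the n-antiprism by subdividing one edge is 4-critical. Here the n-antiprism has vertices x_0, …, x_{n−1}, y_0, …, y_{n−1} with edges x_i x_{i+1}, y_i y_{i+1}, x_i y_i, and x_i y_{i+1} (indices modulo n), and H_n is obtained by replacing one edge by a path of length 2 through a new vertex. -/
open SimpleGraph

variable {V : Type*}

/-- The generating relation of the subdivided antiprism `H_n`.
Vertices: `.inl i` is `x_i`, `.inr (.inl i)` is `y_i`, and `.inr (.inr ())`
is the subdivision vertex `u` (indices are taken modulo `n`, via `ZMod n`).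
Edges: `x_i x_{i+1}` except for `x_0 x_1` (which is subdivided),
`y_i y_{i+1}`, `x_i y_i`, `x_i y_{i+1}`, and `x_0 u`, `x_1 u`. -/
def antiprismSubRel (n : ℕ) :
    (ZMod n ⊕ ZMod n ⊕ Unit) → (ZMod n ⊕ ZMod n ⊕ Unit) → Prop
  | .inl i, .inl j => j = i + 1 ∧ ¬(i = 0 ∧ j = 1)
  | .inr (.inl i), .inr (.inl j) => j = i + 1
  | .inl i, .inr (.inl j) => j = i ∨ j = i + 1
  | .inl i, .inr (.inr _) => i = 0 ∨ i = 1
  | _, _ => False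

/-- `H_n`: the `n`-antiprism with the edge `x_0 x_1` subdivided. -/
def antiprismSub (n : ℕ) : SimpleGraph (ZMod n ⊕ ZMod n ⊕ Unit) :=
  SimpleGraph.fromRel (antiprismSubRel n)

/-- A function assigning to each ordered pair `(v, w)` the color which the edge `vw` has
at its end `v` yields a proper edge coloring once both ends of every edge agree. -/
theorem exists_isProperEdgeColoring_of_halfEdges {W : Type*} (G : SimpleGraph W) (k : ℕ)
    (h : W → W → ℕ) (h_symm : ∀ v w, G.Adj v w → h v w = h w v)
    (h_lt : ∀ v w, G.Adj v w → h v w < k)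
    (h_inj : ∀ v w w', G.Adj v w → G.Adj v w' → w ≠ w' → h v w ≠ h v w') :
    ∃ c, IsProperEdgeColoring G k c := by
  have key : ∀ v w, G.Adj v w →
      h (Quot.out s(v, w)).1 (Quot.out s(v, w)).2 = h v w := by
    intro v w hvw
    have h1 : s((Quot.out s(v, w)).1, (Quot.out s(v, w)).2) = s(v, w) := Quot.out_eq _
    rcases Sym2.eq_iff.1 h1 with ⟨h2, h3⟩ | ⟨h2, h3⟩
    · rw [h2, h3]
    · rw [h2, h3, h_symm v w hvw]
  refine ⟨fun e => h (Quot.out e).1 (Quot.out e).2, ?_, ?_⟩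
  · intro e
    induction e with | _ v w =>
    intro he
    have hvw : G.Adj v w := he
    simpa only [key v w hvw] using h_lt v w hvw
  · rintro e₁ he₁ e₂ he₂ hne ⟨v, hv₁, hv₂⟩
    obtain ⟨w₁, rfl⟩ := Sym2.mem_iff_exists.1 hv₁
    obtain ⟨w₂, rfl⟩ := Sym2.mem_iff_exists.1 hv₂
    have h₁ : G.Adj v w₁ := he₁
    have h₂ : G.Adj v w₂ := he₂
    simp only [key v w₁ h₁, key v w₂ h₂]
    exact h_inj v w₁ w₂ h₁ h₂ (by rintro rfl; exact hne rfl)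

namespace SimpleGraph.Subgraph

/-- In a graph without isolated vertices, every proper subgraph misses an edge. -/
theorem exists_adj_not_adj_of_ne_top {W : Type*} {G : SimpleGraph W}
    (hG : ∀ v, ∃ w, G.Adj v w) {H : G.Subgraph} (hH : H ≠ ⊤) :
    ∃ v w, G.Adj v w ∧ ¬ H.Adj v w := by
  by_contra! hcon
  refine hH (Subgraph.ext ?_ ?_)
  · ext v
    obtain ⟨w, hw⟩ := hG v
    simpa using H.edge_vert (hcon v w hw)
  · ext v w
    exact ⟨fun hvw => H.adj_sub hvw, fun hvw => hcon v w hvw⟩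

end SimpleGraph.Subgraph

/-- If every vertex but one meets all colors `< k` and the remaining one meets at least one
of them, the number of vertices is even. -/
theorem even_card_of_isProperEdgeColoring {W : Type*} [Fintype W] {G : SimpleGraph W} {k : ℕ}
    {c : Sym2 W → ℕ} (hc : IsProperEdgeColoring G k c) {u t : W} (hut : G.Adj u t)
    (hdeg : ∀ v, v ≠ u → deg G v = k) : Even (Fintype.card W) := by
  classical
  have hex : ∀ v, ∃ w, G.Adj v w ∧ c s(v, w) = c s(u, t) := by
    intro v
    by_cases hv : v = u
    · exact ⟨t, hv ▸ hut, by rw [hv]⟩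
    · have hinj : Set.InjOn (fun w => c s(v, w)) (G.neighborSet v) := by
        intro w hw w' hw' heq
        by_contra hne
        exact hc.2 s(v, w) hw s(v, w') hw' (fun h1 => hne (Sym2.congr_right.1 h1))
          ⟨v, by simp, by simp⟩ heq
      have hsub : (fun w => c s(v, w)) '' G.neighborSet v ⊆ (Finset.range k : Set ℕ) := by
        rintro _ ⟨w, hw, rfl⟩
        simpa using hc.1 s(v, w) hw
      have heq := Set.eq_of_subset_of_ncard_le hsub (by
        rw [hinj.ncard_image, Set.ncard_coe_finset, Finset.card_range]
        exact (hdeg v hv).ge)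
      have hmem : c s(u, t) ∈ (fun w => c s(v, w)) '' G.neighborSet v := by
        rw [heq]
        simpa using hc.1 s(u, t) hut
      obtain ⟨w, hw, hw'⟩ := hmem
      exact ⟨w, hw, hw'⟩
  choose f hf hfc using hex
  have hinv : ∀ v, f (f v) = v := by
    intro v
    by_contra hne
    refine hc.2 s(f v, f (f v)) (hf _) s(f v, v) (hf v).symm ?_ ⟨f v, by simp, by simp⟩ ?_
    · exact fun h1 => hne (Sym2.congr_right.1 h1)
    · rw [hfc, Sym2.eq_swap (a := f v) (b := v), hfc]
  have hsum : ∑ _v : W, (1 : ZMod 2) = 0 :=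
    Finset.sum_involution (fun v _ => f v) (fun _ _ => by decide)
      (fun v _ _ => (hf v).ne') (fun _ _ => Finset.mem_univ _) (fun v _ => hinv v)
  rw [Finset.sum_const, nsmul_one, Finset.card_univ] at hsum
  exact (ZMod.natCast_eq_zero_iff_even).1 hsum

/-- A graph whose number of vertices is odd and in which all vertices but one have degree `k`
is not `k`-edge-colorable if the remaining vertex is not isolated. -/
theorem lt_edgeChromaticNumber_of_odd_card {W : Type*} [Fintype W] {G : SimpleGraph W} {k : ℕ}
    {u t : W} (hut : G.Adj u t) (hdeg : ∀ v, v ≠ u → deg G v = k)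
    (hodd : Odd (Fintype.card W)) : k < edgeChromaticNumber G := by
  classical
  have hne : {m | ∃ c, IsProperEdgeColoring G m c}.Nonempty := by
    refine ⟨Fintype.card (Sym2 W), fun e => Fintype.equivFin (Sym2 W) e,
      fun e _ => (Fintype.equivFin (Sym2 W) e).2, fun e₁ _ e₂ _ hne _ heq => hne ?_⟩
    exact (Fintype.equivFin (Sym2 W)).injective (Fin.ext heq)
  by_contra! hle
  obtain ⟨c, hc⟩ := Nat.sInf_mem hne
  have hc' : IsProperEdgeColoring G k c := ⟨fun e he => (hc.1 e he).trans_le hle, hc.2⟩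
  exact Nat.not_even_iff_odd.2 hodd (even_card_of_isProperEdgeColoring hc' hut hdeg)

namespace antiprismSub

variable {n : ℕ}

theorem one_ne_zero_zmod (hn : 3 ≤ n) : (1 : ZMod n) ≠ 0 := by
  have : Fact (1 < n) := ⟨by omega⟩
  exact one_ne_zero

theorem add_one_ne_self (hn : 3 ≤ n) (i : ZMod n) : i + 1 ≠ i := by
  simpa using one_ne_zero_zmod hn

theorem add_one_add_one_ne_self (hn : 3 ≤ n) (i : ZMod n) : i + 1 + 1 ≠ i := by
  intro h
  have h2 : ((2 : ℕ) : ZMod n) = 0 := by push_cast; linear_combination h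
  rw [ZMod.natCast_eq_zero_iff] at h2
  exact absurd (Nat.le_of_dvd (by norm_num) h2) (by omega)

theorem adj_x_x (hn : 3 ≤ n) (i j : ZMod n) : (antiprismSub n).Adj (.inl i) (.inl j) ↔
    (j = i + 1 ∧ i ≠ 0) ∨ (i = j + 1 ∧ j ≠ 0) := by
  have := add_one_ne_self hn i
  have := add_one_ne_self hn j
  simp only [antiprismSub, fromRel_adj, antiprismSubRel, ne_eq, Sum.inl.injEq]
  grind

theorem adj_y_y (hn : 3 ≤ n) (i j : ZMod n) :
    (antiprismSub n).Adj (.inr (.inl i)) (.inr (.inl j)) ↔ j = i + 1 ∨ i = j + 1 := by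
  have := add_one_ne_self hn i
  have := add_one_ne_self hn j
  simp only [antiprismSub, fromRel_adj, antiprismSubRel, ne_eq, Sum.inl.injEq, Sum.inr.injEq]
  grind

theorem adj_x_y (i j : ZMod n) :
    (antiprismSub n).Adj (.inl i) (.inr (.inl j)) ↔ j = i ∨ j = i + 1 := by
  simp [antiprismSub, antiprismSubRel]

theorem adj_y_x (i j : ZMod n) :
    (antiprismSub n).Adj (.inr (.inl j)) (.inl i) ↔ j = i ∨ j = i + 1 := by
  rw [adj_comm, adj_x_y]

theorem adj_x_u (i : ZMod n) (t : Unit) :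
    (antiprismSub n).Adj (.inl i) (.inr (.inr t)) ↔ i = 0 ∨ i = 1 := by
  simp [antiprismSub, antiprismSubRel]

theorem adj_u_x (i : ZMod n) (t : Unit) :
    (antiprismSub n).Adj (.inr (.inr t)) (.inl i) ↔ i = 0 ∨ i = 1 := by
  rw [adj_comm, adj_x_u]

theorem not_adj_y_u (i : ZMod n) (t : Unit) :
    ¬ (antiprismSub n).Adj (.inr (.inl i)) (.inr (.inr t)) := by
  simp [antiprismSub, antiprismSubRel]

theorem not_adj_u_y (i : ZMod n) (t : Unit) :
    ¬ (antiprismSub n).Adj (.inr (.inr t)) (.inr (.inl i)) := by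
  simp [antiprismSub, antiprismSubRel]

theorem not_adj_u_u (s t : Unit) :
    ¬ (antiprismSub n).Adj (.inr (.inr s)) (.inr (.inr t)) := by
  simp [antiprismSub]

theorem deg_x (hn : 3 ≤ n) (i : ZMod n) : deg (antiprismSub n) (.inl i) = 4 := by
  classical
  have h1 := one_ne_zero_zmod hn
  have h2 := add_one_add_one_ne_self hn (i - 1)
  have hset : (antiprismSub n).neighborSet (.inl i) =
      (({if i = 0 then .inr (.inr ()) else .inl (i + 1),
        if i = 1 then .inr (.inr ()) else .inl (i - 1), .inr (.inl i), .inr (.inl (i + 1))} :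
        Finset (ZMod n ⊕ ZMod n ⊕ Unit)) : Set (ZMod n ⊕ ZMod n ⊕ Unit)) := by
    ext (j | j | t)
    · simp only [mem_neighborSet, adj_x_x hn]
      grind
    · simp only [mem_neighborSet, adj_x_y]
      grind
    · simp only [mem_neighborSet, adj_x_u]
      grind
  rw [deg, hset, Set.ncard_coe_finset]
  have h3 : i + 1 ≠ i - 1 := by simpa using h2
  have h4 : i + 1 ≠ i := add_one_ne_self hn i
  rw [Finset.card_insert_of_notMem, Finset.card_insert_of_notMem, Finset.card_insert_of_notMem,
    Finset.card_singleton]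
  all_goals grind

theorem deg_y (hn : 3 ≤ n) (i : ZMod n) : deg (antiprismSub n) (.inr (.inl i)) = 4 := by
  classical
  have h2 := add_one_add_one_ne_self hn (i - 1)
  have hset : (antiprismSub n).neighborSet (.inr (.inl i)) =
      (({.inr (.inl (i + 1)), .inr (.inl (i - 1)), .inl i, .inl (i - 1)} :
        Finset (ZMod n ⊕ ZMod n ⊕ Unit)) : Set (ZMod n ⊕ ZMod n ⊕ Unit)) := by
    have h6 : ∀ j, j = i - 1 ↔ i = j + 1 := fun j => by rw [eq_sub_iff_add_eq, eq_comm]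
    ext (j | j | t)
    · simp only [mem_neighborSet, adj_y_x]
      grind
    · simp only [mem_neighborSet, adj_y_y hn]
      grind
    · simp only [mem_neighborSet, not_adj_y_u]
      grind
  rw [deg, hset, Set.ncard_coe_finset]
  have h3 : i + 1 ≠ i - 1 := by simpa using h2
  have h4 : i ≠ i - 1 := by simpa using add_one_ne_self hn (i - 1)
  rw [Finset.card_insert_of_notMem, Finset.card_insert_of_notMem, Finset.card_insert_of_notMem,
    Finset.card_singleton]
  all_goals grind

theorem deg_u_le (t : Unit) : deg (antiprismSub n) (.inr (.inr t)) ≤ 4 := by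
  have hset : (antiprismSub n).neighborSet (.inr (.inr t)) ⊆ {.inl 0, .inl 1} := by
    rintro (j | j | s)
    · simp only [mem_neighborSet, adj_u_x]
      grind
    · simp only [mem_neighborSet, not_adj_u_y]
      grind
    · simp only [mem_neighborSet, not_adj_u_u]
      grind
  refine (Set.ncard_le_ncard hset).trans ((Set.ncard_insert_le _ _).trans ?_)
  rw [Set.ncard_singleton]
  norm_num

theorem maxDeg_eq (hn : 3 ≤ n) : maxDeg (antiprismSub n) = 4 := by
  refine IsGreatest.csSup_eq ⟨⟨_, deg_x hn 0⟩, ?_⟩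
  rintro d ⟨i | i | t, rfl⟩
  · exact (deg_x hn i).le
  · exact (deg_y hn i).le
  · exact deg_u_le t

theorem four_lt_edgeChromaticNumber (hn : 3 ≤ n) : 4 < edgeChromaticNumber (antiprismSub n) := by
  have : NeZero n := ⟨by omega⟩
  refine lt_edgeChromaticNumber_of_odd_card (u := .inr (.inr ())) (t := .inl 0)
    ((adj_u_x _ _).2 (Or.inl rfl)) ?_ ?_
  · rintro (i | i | t) hv
    · exact deg_x hn i
    · exact deg_y hn i
    · exact absurd rfl hv
  · simp only [Fintype.card_sum, ZMod.card, Fintype.card_unit]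
    exact ⟨n, by ring⟩

/-- Given a proper coloring `a` of the `n`-cycle with colors `0, 1, 2`, this is a proper
4-edge-coloring of the antiprism, except that the color of `x_0 x_1` is copied to both
edges at the subdivision vertex. The edges `x_i y_{i+1}` get color `3`. -/
def baseColor (a : ZMod n → ℕ) :
    (ZMod n ⊕ ZMod n ⊕ Unit) → (ZMod n ⊕ ZMod n ⊕ Unit) → ℕ
  | .inl i, .inl j => if j = i + 1 then a i else a j
  | .inr (.inl i), .inr (.inl j) => if j = i + 1 then a i else a j
  | .inl i, .inr (.inl j) => if j = i + 1 then 3 else 3 - a (i - 1) - a i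
  | .inr (.inl j), .inl i => if j = i + 1 then 3 else 3 - a (i - 1) - a i
  | _, _ => a 0

theorem baseColor_symm (hn : 3 ≤ n) (a : ZMod n → ℕ) (v w : ZMod n ⊕ ZMod n ⊕ Unit)
    (h : (antiprismSub n).Adj v w) : baseColor a v w = baseColor a w v := by
  rcases v with i | i | s <;> rcases w with j | j | t <;> simp only [baseColor]
  · have := add_one_add_one_ne_self hn i
    have := add_one_add_one_ne_self hn j
    rw [adj_x_x hn] at h
    grind
  · have := add_one_add_one_ne_self hn i
    have := add_one_add_one_ne_self hn j
    rw [adj_y_y hn] at h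
    grind

theorem baseColor_lt {a : ZMod n → ℕ} (ha : ∀ i, a i < 3) (v w : ZMod n ⊕ ZMod n ⊕ Unit) :
    baseColor a v w < 4 := by
  rcases v with i | i | s <;> rcases w with j | j | t <;> simp only [baseColor] <;>
    first
    | (have := ha 0; omega)
    | (have := ha i; have := ha j; split_ifs <;> omega)

theorem baseColor_x (hn : 3 ≤ n) (a : ZMod n → ℕ) (i : ZMod n) (w : ZMod n ⊕ ZMod n ⊕ Unit)
    (hw : (antiprismSub n).Adj (.inl i) w) :
    (w = (if i = 0 then .inr (.inr ()) else .inl (i + 1)) ∧ baseColor a (.inl i) w = a i) ∨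
    (w = (if i = 1 then .inr (.inr ()) else .inl (i - 1)) ∧
      baseColor a (.inl i) w = a (i - 1)) ∨
    (w = .inr (.inl i) ∧ baseColor a (.inl i) w = 3 - a (i - 1) - a i) ∨
    (w = .inr (.inl (i + 1)) ∧ baseColor a (.inl i) w = 3) := by
  have h2 := add_one_add_one_ne_self hn
  have h3 := add_one_ne_self hn
  rcases w with j | j | t
  · rw [adj_x_x hn] at hw
    rcases hw with ⟨rfl, h⟩ | ⟨rfl, h⟩
    · simp [baseColor, h]
    · simp [baseColor, h, (h2 j).symm]
  · rw [adj_x_y] at hw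
    rcases hw with rfl | rfl
    · simp [baseColor, (h3 j).symm]
    · simp [baseColor]
  · rw [adj_x_u] at hw
    rcases hw with rfl | rfl
    · simp [baseColor]
    · simp [baseColor]

theorem baseColor_y (hn : 3 ≤ n) (a : ZMod n → ℕ) (i : ZMod n) (w : ZMod n ⊕ ZMod n ⊕ Unit)
    (hw : (antiprismSub n).Adj (.inr (.inl i)) w) :
    (w = .inr (.inl (i + 1)) ∧ baseColor a (.inr (.inl i)) w = a i) ∨
    (w = .inr (.inl (i - 1)) ∧ baseColor a (.inr (.inl i)) w = a (i - 1)) ∨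
    (w = .inl i ∧ baseColor a (.inr (.inl i)) w = 3 - a (i - 1) - a i) ∨
    (w = .inl (i - 1) ∧ baseColor a (.inr (.inl i)) w = 3) := by
  have h2 := add_one_add_one_ne_self hn
  have h3 := add_one_ne_self hn
  rcases w with j | j | t
  · rw [adj_y_x] at hw
    rcases hw with rfl | rfl
    · simp [baseColor, (h3 i).symm]
    · simp [baseColor]
  · rw [adj_y_y hn] at hw
    rcases hw with rfl | rfl
    · simp [baseColor]
    · simp [baseColor, (h2 j).symm]
  · exact absurd hw (not_adj_y_u i t)

theorem baseColor_injOn (hn : 3 ≤ n) {a : ZMod n → ℕ} (ha : ∀ i, a i < 3)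
    (ha' : ∀ i, a i ≠ a (i + 1)) (v w w' : ZMod n ⊕ ZMod n ⊕ Unit)
    (hv : v ≠ .inr (.inr ())) (hw : (antiprismSub n).Adj v w) (hw' : (antiprismSub n).Adj v w')
    (hne : w ≠ w') : baseColor a v w ≠ baseColor a v w' := by
  rcases v with i | i | s
  · have hi := ha i
    have hi' := ha (i - 1)
    have hii := ha' (i - 1)
    rw [sub_add_cancel] at hii
    rcases baseColor_x hn a i w hw with ⟨h, h'⟩ | ⟨h, h'⟩ | ⟨h, h'⟩ | ⟨h, h'⟩ <;>
    rcases baseColor_x hn a i w' hw' with ⟨k, k'⟩ | ⟨k, k'⟩ | ⟨k, k'⟩ | ⟨k, k'⟩ <;>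
    first
    | exact absurd (h.trans k.symm) hne
    | (rw [h', k']; omega)
  · have hi := ha i
    have hi' := ha (i - 1)
    have hii := ha' (i - 1)
    rw [sub_add_cancel] at hii
    rcases baseColor_y hn a i w hw with ⟨h, h'⟩ | ⟨h, h'⟩ | ⟨h, h'⟩ | ⟨h, h'⟩ <;>
    rcases baseColor_y hn a i w' hw' with ⟨k, k'⟩ | ⟨k, k'⟩ | ⟨k, k'⟩ | ⟨k, k'⟩ <;>
    first
    | exact absurd (h.trans k.symm) hne
    | (rw [h', k']; omega)
  · exact absurd rfl hv

open Classical in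
/-- The color `c`, with `α` and `β` exchanged if `p` holds. -/
noncomputable def kempe (p : Prop) (α β c : ℕ) : ℕ :=
  if p then Equiv.swap α β c else c

theorem kempe_congr {p q : Prop} {α β c : ℕ} (h : c = α ∨ c = β → (p ↔ q)) :
    kempe p α β c = kempe q α β c := by
  by_cases hc : c = α ∨ c = β
  · rw [show p = q from propext (h hc)]
  · rw [not_or] at hc
    simp [kempe, Equiv.swap_apply_of_ne_of_ne hc.1 hc.2]

theorem kempe_lt {p : Prop} {α β c k : ℕ} (hα : α < k) (hβ : β < k) (hc : c < k) :
    kempe p α β c < k := by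
  rw [kempe, Equiv.swap_apply_def]
  split_ifs <;> assumption

theorem kempe_injective (p : Prop) (α β : ℕ) : Function.Injective (kempe p α β) := by
  by_cases hp : p
  · have : kempe p α β = Equiv.swap α β := by ext c; simp [kempe, hp]
    exact this ▸ (Equiv.swap α β).injective
  · have : kempe p α β = id := by ext c; simp [kempe, hp]
    exact this ▸ Function.injective_id

theorem kempe_ne_kempe {p q : Prop} {α β c : ℕ} (hαβ : α ≠ β) (hc : c = α ∨ c = β)
    (h : p ↔ ¬ q) : kempe p α β c ≠ kempe q α β c := by
  by_cases hq : q
  · have hp : ¬ p := fun hp => h.1 hp hq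
    rcases hc with rfl | rfl <;> simp [kempe, hp, hq, hαβ, hαβ.symm]
  · have hp : p := h.2 hq
    rcases hc with rfl | rfl <;> simp [kempe, hp, hq, hαβ, hαβ.symm]

/-- The colors seen at the ends of the edges after exchanging `α` and `β` at the vertices
`x_i` with `P i` and `y_i` with `Q i`. -/
noncomputable def halfColor (a : ZMod n → ℕ) (P Q : ZMod n → Prop) (α β : ℕ) :
    (ZMod n ⊕ ZMod n ⊕ Unit) → (ZMod n ⊕ ZMod n ⊕ Unit) → ℕ
  | .inl i, w => kempe (P i) α β (baseColor a (.inl i) w)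
  | .inr (.inl i), w => kempe (Q i) α β (baseColor a (.inr (.inl i)) w)
  | .inr (.inr _), .inl i => kempe (P i) α β (a 0)
  | .inr (.inr _), .inr _ => a 0

/-- If the exchange of `α` and `β` only spoils edges outside `H`, then `H` is
4-edge-colorable. -/
theorem edgeChromaticNumber_coe_le_four (hn : 3 ≤ n) (H : (antiprismSub n).Subgraph)
    {a : ZMod n → ℕ} (ha : ∀ i, a i < 3) (ha' : ∀ i, a i ≠ a (i + 1)) (P Q : ZMod n → Prop)
    {α β : ℕ} (hα : α < 4) (hβ : β < 4) (hαβ : α ≠ β)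
    (hx : ∀ i, i ≠ 0 → H.Adj (.inl i) (.inl (i + 1)) → a i = α ∨ a i = β →
      (P i ↔ P (i + 1)))
    (hy : ∀ i, H.Adj (.inr (.inl i)) (.inr (.inl (i + 1))) → a i = α ∨ a i = β →
      (Q i ↔ Q (i + 1)))
    (hr : ∀ i, H.Adj (.inl (i + 1)) (.inr (.inl (i + 1))) →
      3 - a i - a (i + 1) = α ∨ 3 - a i - a (i + 1) = β → (P (i + 1) ↔ Q (i + 1)))
    (hs : ∀ i, H.Adj (.inl i) (.inr (.inl (i + 1))) → 3 = α ∨ 3 = β → (P i ↔ Q (i + 1)))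
    (hu : ¬ H.Adj (.inl 0) (.inr (.inr ())) ∨ ¬ H.Adj (.inl 1) (.inr (.inr ())) ∨
      ((a 0 = α ∨ a 0 = β) ∧ (P 0 ↔ ¬ P 1))) :
    edgeChromaticNumber H.coe ≤ 4 := by
  have h2 := add_one_add_one_ne_self hn
  have h3 := add_one_ne_self hn
  refine Nat.sInf_le (exists_isProperEdgeColoring_of_halfEdges H.coe 4
    (fun v w => halfColor a P Q α β v w) ?_ ?_ ?_)
  · have hxx : ∀ i j, j = i + 1 → i ≠ 0 → H.Adj (.inl i) (.inl j) →
        halfColor a P Q α β (.inl i) (.inl j) = halfColor a P Q α β (.inl j) (.inl i) := by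
      rintro i _ rfl hi h
      simpa [halfColor, baseColor, (h2 i).symm] using kempe_congr (hx i hi h)
    have hyy : ∀ i j, j = i + 1 → H.Adj (.inr (.inl i)) (.inr (.inl j)) →
        halfColor a P Q α β (.inr (.inl i)) (.inr (.inl j)) =
          halfColor a P Q α β (.inr (.inl j)) (.inr (.inl i)) := by
      rintro i _ rfl h
      simpa [halfColor, baseColor, (h2 i).symm] using kempe_congr (hy i h)
    have hxy : ∀ i j, H.Adj (.inl i) (.inr (.inl j)) →
        halfColor a P Q α β (.inl i) (.inr (.inl j)) =
          halfColor a P Q α β (.inr (.inl j)) (.inl i) := by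
      intro i j h
      rcases (adj_x_y i j).1 (H.adj_sub h) with rfl | rfl
      · have := hr (j - 1)
        rw [sub_add_cancel] at this
        simpa [halfColor, baseColor, (h3 j).symm] using kempe_congr (this h)
      · simpa [halfColor, baseColor] using kempe_congr (hs i h)
    rintro ⟨i | i | s, hv⟩ ⟨j | j | t, hw⟩ (h : H.Adj _ _)
    · rcases (adj_x_x hn i j).1 (H.adj_sub h) with ⟨h', h''⟩ | ⟨h', h''⟩
      · exact hxx i j h' h'' h
      · exact (hxx j i h' h'' h.symm).symm
    · exact hxy i j h
    · rfl
    · exact (hxy j i h.symm).symm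
    · rcases (adj_y_y hn i j).1 (H.adj_sub h) with h' | h'
      · exact hyy i j h' h
      · exact (hyy j i h' h.symm).symm
    · exact absurd (H.adj_sub h) (not_adj_y_u i t)
    · rfl
    · exact absurd (H.adj_sub h) (not_adj_u_y j s)
    · exact absurd (H.adj_sub h) (not_adj_u_u s t)
  · rintro ⟨i | i | s, hv⟩ ⟨j | j | t, hw⟩ -
    all_goals
      simp only [halfColor]
      first
      | exact kempe_lt hα hβ (baseColor_lt ha _ _)
      | exact kempe_lt hα hβ ((ha 0).trans (by norm_num))
      | exact (ha 0).trans (by norm_num)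
  · rintro ⟨i | i | s, hv⟩ ⟨w, hw⟩ ⟨w', hw'⟩ (h : H.Adj _ w) (h' : H.Adj _ w') hne
    · exact (kempe_injective _ _ _).ne (baseColor_injOn hn ha ha' _ w w' (by simp)
        (H.adj_sub h) (H.adj_sub h') fun hww => hne (Subtype.ext hww))
    · exact (kempe_injective _ _ _).ne (baseColor_injOn hn ha ha' _ w w' (by simp)
        (H.adj_sub h) (H.adj_sub h') fun hww => hne (Subtype.ext hww))
    · rcases w with i | i | t
      · rcases w' with j | j | t'
        · rcases (adj_u_x i s).1 (H.adj_sub h) with rfl | rfl <;>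
          rcases (adj_u_x j s).1 (H.adj_sub h') with rfl | rfl
          · exact absurd rfl hne
          · rcases hu with hu | hu | ⟨hu, hu'⟩
            · exact absurd h.symm hu
            · exact absurd h'.symm hu
            · exact kempe_ne_kempe hαβ hu hu'
          · rcases hu with hu | hu | ⟨hu, hu'⟩
            · exact absurd h'.symm hu
            · exact absurd h.symm hu
            · exact (kempe_ne_kempe hαβ hu hu').symm
          · exact absurd rfl hne
        · exact absurd (H.adj_sub h') (not_adj_u_y j s)
        · exact absurd (H.adj_sub h') (not_adj_u_u s t')
      · exact absurd (H.adj_sub h) (not_adj_u_y i s)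
      · exact absurd (H.adj_sub h) (not_adj_u_u s t)

theorem val_add_one_eq (hn : 3 ≤ n) (i : ZMod n) :
    (i + 1).val = if i.val + 1 = n then 0 else i.val + 1 := by
  have : Fact (1 < n) := ⟨by omega⟩
  have hi := i.val_lt
  rw [ZMod.val_add, ZMod.val_one]
  split_ifs with h
  · rw [h, Nat.mod_self]
  · exact Nat.mod_eq_of_lt (by omega)

theorem val_one_eq (hn : 3 ≤ n) : (1 : ZMod n).val = 1 := by
  have : Fact (1 < n) := ⟨by omega⟩
  exact ZMod.val_one n

/-- A proper coloring of the cycle on `0, …, n - 1` with colors `0, 1, 2` in which exactly `0`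
and `k` get color `0`, provided that `0` and `k` are equal or at distance at least two. -/
def cycleColor (k m : ℕ) : ℕ :=
  if m = 0 ∨ m = k then 0 else 1 + m % 2

theorem cycleColor_lt (k m : ℕ) : cycleColor k m < 3 := by
  unfold cycleColor
  split_ifs <;> omega

theorem cycleColor_val_ne (hn : 3 ≤ n) {k : ℕ} (hk : k ≠ 1) (hk' : k + 1 ≠ n) (i : ZMod n) :
    cycleColor k i.val ≠ cycleColor k (i + 1).val := by
  have h := val_add_one_eq hn i
  unfold cycleColor
  split_ifs at h ⊢ <;> omega

/-- Exchanging `α` and `β` on a set of vertices described by the indices, in the coloring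
coming from `cycleColor k`. -/
theorem edgeChromaticNumber_coe_le_four_of_val (hn : 3 ≤ n) (H : (antiprismSub n).Subgraph)
    (k : ℕ) (hk : k ≠ 1) (hk' : k + 1 ≠ n) (P Q : ℕ → Prop)
    (α β : ℕ) (hα : α < 4) (hβ : β < 4) (hαβ : α ≠ β)
    (h : ∀ (i : ZMod n) (m m' : ℕ), i.val = m → (i + 1).val = m' → m < n →
      (m + 1 = n ∧ m' = 0 ∨ m + 1 < n ∧ m' = m + 1) →
      (m ≠ 0 → H.Adj (.inl i) (.inl (i + 1)) →
        cycleColor k m = α ∨ cycleColor k m = β → (P m ↔ P m')) ∧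
      (H.Adj (.inr (.inl i)) (.inr (.inl (i + 1))) →
        cycleColor k m = α ∨ cycleColor k m = β → (Q m ↔ Q m')) ∧
      (H.Adj (.inl (i + 1)) (.inr (.inl (i + 1))) →
        3 - cycleColor k m - cycleColor k m' = α ∨ 3 - cycleColor k m - cycleColor k m' = β →
        (P m' ↔ Q m')) ∧
      (H.Adj (.inl i) (.inr (.inl (i + 1))) → 3 = α ∨ 3 = β → (P m ↔ Q m')))
    (hu : ¬ H.Adj (.inl 0) (.inr (.inr ())) ∨ ¬ H.Adj (.inl 1) (.inr (.inr ())) ∨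
      ((0 = α ∨ 0 = β) ∧ (P 0 ↔ ¬ P 1))) :
    edgeChromaticNumber H.coe ≤ 4 := by
  have : NeZero n := ⟨by omega⟩
  have key : ∀ i : ZMod n, _ := fun i => h i i.val (i + 1).val rfl rfl i.val_lt (by
    have h1 := val_add_one_eq hn i
    have h2 := i.val_lt
    split_ifs at h1 <;> omega)
  refine edgeChromaticNumber_coe_le_four hn H (a := fun i => cycleColor k i.val)
    (fun _ => cycleColor_lt k _) (cycleColor_val_ne hn hk hk')
    (fun i => P i.val) (fun i => Q i.val) hα hβ hαβ (fun i hi => (key i).1 (by simpa using hi))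
    (fun i => (key i).2.1) (fun i => (key i).2.2.1) (fun i => (key i).2.2.2) ?_
  simpa [cycleColor, val_one_eq hn] using hu

theorem edgeChromaticNumber_coe_le_four_of_not_adj_x_u (hn : 3 ≤ n)
    (H : (antiprismSub n).Subgraph) (hH : ¬ H.Adj (.inl 0) (.inr (.inr ())) ∨
      ¬ H.Adj (.inl 1) (.inr (.inr ()))) : edgeChromaticNumber H.coe ≤ 4 :=
  edgeChromaticNumber_coe_le_four_of_val hn H 0 (by omega) (by omega) (fun _ => False)
    (fun _ => False) 0 3 (by omega) (by omega) (by omega) (by simp) (by tauto)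

theorem edgeChromaticNumber_coe_le_four_of_not_adj_x_x (hn : 3 ≤ n)
    (H : (antiprismSub n).Subgraph) (j : ZMod n) (hj : j ≠ 0)
    (hH : ¬ H.Adj (.inl j) (.inl (j + 1))) : edgeChromaticNumber H.coe ≤ 4 := by
  have : NeZero n := ⟨by omega⟩
  have hj0 : j.val ≠ 0 := by simpa using hj
  have hjn := j.val_lt
  have hex : ∀ i : ZMod n, H.Adj (.inl i) (.inl (i + 1)) → i.val ≠ j.val :=
    fun i hi hij => hH (ZMod.val_injective n hij ▸ hi)
  by_cases h1 : j.val = 1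
  · refine edgeChromaticNumber_coe_le_four_of_val hn H 0 (by omega) (by omega)
      (fun m => m = 1) (fun _ => False) 0 2 (by omega) (by omega) (by omega) ?_ (by simp)
    grind [cycleColor]
  by_cases h2 : j.val + 1 = n
  · refine edgeChromaticNumber_coe_le_four_of_val hn H 0 (by omega) (by omega)
      (fun m => m = 0) (fun _ => False) 0 (1 + j.val % 2) (by omega) (by omega) (by omega) ?_
      (by simp)
    grind [cycleColor]
  · refine edgeChromaticNumber_coe_le_four_of_val hn H j.val (by omega) (by omega)
      (fun m => 1 ≤ m ∧ m ≤ j.val) (fun m => 2 ≤ m ∧ m ≤ j.val + 1) 0 3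
      (by omega) (by omega) (by omega) ?_ (by grind)
    grind [cycleColor]

theorem edgeChromaticNumber_coe_le_four_of_not_adj_y_y (hn : 3 ≤ n)
    (H : (antiprismSub n).Subgraph) (j : ZMod n)
    (hH : ¬ H.Adj (.inr (.inl j)) (.inr (.inl (j + 1)))) : edgeChromaticNumber H.coe ≤ 4 := by
  have : NeZero n := ⟨by omega⟩
  have hjn := j.val_lt
  have hex : ∀ i : ZMod n, H.Adj (.inr (.inl i)) (.inr (.inl (i + 1))) → i.val ≠ j.val :=
    fun i hi hij => hH (ZMod.val_injective n hij ▸ hi)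
  by_cases h0 : j.val = 0
  · refine edgeChromaticNumber_coe_le_four_of_val hn H 0 (by omega) (by omega)
      (fun m => m = 0) (fun m => m = 1) 0 3 (by omega) (by omega) (by omega) ?_ (by simp)
    grind [cycleColor]
  by_cases h1 : j.val = 1
  · refine edgeChromaticNumber_coe_le_four_of_val hn H 0 (by omega) (by omega)
      (fun m => m = 1 ∨ m = 2) (fun m => m = 2) 0 2 (by omega) (by omega) (by omega) ?_
      (by simp)
    grind [cycleColor]
  by_cases h2 : j.val + 1 = n
  · refine edgeChromaticNumber_coe_le_four_of_val hn H 0 (by omega) (by omega)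
      (fun m => m = 0 ∨ m = j.val) (fun m => m = j.val) 0 (1 + j.val % 2)
      (by omega) (by omega) (by omega) ?_ (by grind)
    grind [cycleColor]
  · refine edgeChromaticNumber_coe_le_four_of_val hn H j.val (by omega) (by omega)
      (fun m => 1 ≤ m ∧ m < j.val) (fun m => 2 ≤ m ∧ m ≤ j.val) 0 3
      (by omega) (by omega) (by omega) ?_ (by grind)
    grind [cycleColor]

theorem edgeChromaticNumber_coe_le_four_of_not_adj_x_y_self (hn : 3 ≤ n)
    (H : (antiprismSub n).Subgraph) (j : ZMod n)
    (hH : ¬ H.Adj (.inl j) (.inr (.inl j))) : edgeChromaticNumber H.coe ≤ 4 := by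
  have : NeZero n := ⟨by omega⟩
  have hjn := j.val_lt
  have hex : ∀ i : ZMod n, H.Adj (.inl (i + 1)) (.inr (.inl (i + 1))) →
      (i + 1).val ≠ j.val :=
    fun i hi hij => hH (ZMod.val_injective n hij ▸ hi)
  by_cases h0 : j.val = 0
  · refine edgeChromaticNumber_coe_le_four_of_val hn H 0 (by omega) (by omega)
      (fun m => m = 0) (fun _ => False) 0 (2 - (n - 1) % 2) (by omega) (by omega) (by omega) ?_
      (by simp)
    grind [cycleColor]
  by_cases h1 : j.val = 1
  · refine edgeChromaticNumber_coe_le_four_of_val hn H 0 (by omega) (by omega)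
      (fun m => m = 1) (fun _ => False) 0 1 (by omega) (by omega) (by omega) ?_ (by simp)
    grind [cycleColor]
  · refine edgeChromaticNumber_coe_le_four_of_val hn H 0 (by omega) (by omega)
      (fun m => 1 ≤ m ∧ m < j.val) (fun m => 2 ≤ m ∧ m ≤ j.val) 0 3
      (by omega) (by omega) (by omega) ?_ (by grind)
    grind [cycleColor]

theorem edgeChromaticNumber_coe_le_four_of_not_adj_x_y_succ (hn : 3 ≤ n)
    (H : (antiprismSub n).Subgraph) (j : ZMod n)
    (hH : ¬ H.Adj (.inl j) (.inr (.inl (j + 1)))) : edgeChromaticNumber H.coe ≤ 4 := by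
  have : NeZero n := ⟨by omega⟩
  have hjn := j.val_lt
  have hex : ∀ i : ZMod n, H.Adj (.inl i) (.inr (.inl (i + 1))) → i.val ≠ j.val :=
    fun i hi hij => hH (ZMod.val_injective n hij ▸ hi)
  by_cases h0 : j.val = 0
  · refine edgeChromaticNumber_coe_le_four_of_val hn H 0 (by omega) (by omega)
      (fun m => m = 0) (fun _ => False) 0 3 (by omega) (by omega) (by omega) ?_ (by simp)
    grind [cycleColor]
  · refine edgeChromaticNumber_coe_le_four_of_val hn H 0 (by omega) (by omega)
      (fun m => 1 ≤ m ∧ m ≤ j.val) (fun m => 2 ≤ m ∧ m ≤ j.val) 0 3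
      (by omega) (by omega) (by omega) ?_ (by grind)
    grind [cycleColor]

theorem edgeChromaticNumber_coe_le_four_of_not_adj (hn : 3 ≤ n) (H : (antiprismSub n).Subgraph)
    (v w : ZMod n ⊕ ZMod n ⊕ Unit) (hvw : (antiprismSub n).Adj v w) (hH : ¬ H.Adj v w) :
    edgeChromaticNumber H.coe ≤ 4 := by
  have hH' : ¬ H.Adj w v := fun h => hH h.symm
  have hxy : ∀ i j, j = i ∨ j = i + 1 → ¬ H.Adj (.inl i) (.inr (.inl j)) →
      edgeChromaticNumber H.coe ≤ 4 := by
    rintro i j (rfl | rfl) h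
    · exact edgeChromaticNumber_coe_le_four_of_not_adj_x_y_self hn H _ h
    · exact edgeChromaticNumber_coe_le_four_of_not_adj_x_y_succ hn H i h
  have hxu : ∀ i, i = 0 ∨ i = 1 → ¬ H.Adj (.inl i) (.inr (.inr ())) →
      edgeChromaticNumber H.coe ≤ 4 := by
    rintro i (rfl | rfl) h
    · exact edgeChromaticNumber_coe_le_four_of_not_adj_x_u hn H (Or.inl h)
    · exact edgeChromaticNumber_coe_le_four_of_not_adj_x_u hn H (Or.inr h)
  rcases v with i | i | s <;> rcases w with j | j | t
  · rcases (adj_x_x hn i j).1 hvw with ⟨rfl, h⟩ | ⟨rfl, h⟩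
    · exact edgeChromaticNumber_coe_le_four_of_not_adj_x_x hn H i h hH
    · exact edgeChromaticNumber_coe_le_four_of_not_adj_x_x hn H j h hH'
  · exact hxy i j ((adj_x_y i j).1 hvw) hH
  · exact hxu i ((adj_x_u i t).1 hvw) hH
  · exact hxy j i ((adj_y_x j i).1 hvw) hH'
  · rcases (adj_y_y hn i j).1 hvw with rfl | rfl
    · exact edgeChromaticNumber_coe_le_four_of_not_adj_y_y hn H i hH
    · exact edgeChromaticNumber_coe_le_four_of_not_adj_y_y hn H j hH'
  · exact absurd hvw (not_adj_y_u i t)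
  · exact hxu j ((adj_u_x j s).1 hvw) hH'
  · exact absurd hvw (not_adj_u_y j s)
  · exact absurd hvw (not_adj_u_u s t)

theorem exists_adj (v : ZMod n ⊕ ZMod n ⊕ Unit) : ∃ w, (antiprismSub n).Adj v w := by
  rcases v with i | i | s
  · exact ⟨.inr (.inl i), (adj_x_y i i).2 (Or.inl rfl)⟩
  · exact ⟨.inl i, (adj_y_x i i).2 (Or.inl rfl)⟩
  · exact ⟨.inl 0, (adj_u_x 0 s).2 (Or.inl rfl)⟩

end antiprismSub

/-- For every `n ≥ 3`, the graph obtained from the `n`-antiprism by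
subdividing one edge is 4-critical. -/
theorem antiprismSub_four_critical (n : ℕ) (hn : 3 ≤ n) :
    IsKCritical (antiprismSub n) 4 := by
  have h5 := antiprismSub.four_lt_edgeChromaticNumber hn
  have h4 := antiprismSub.maxDeg_eq hn
  refine ⟨⟨h4 ▸ h5.ne', fun H hH => ?_⟩, h4⟩
  obtain ⟨v, w, hvw, hH'⟩ := Subgraph.exists_adj_not_adj_of_ne_top antiprismSub.exists_adj hH
  exact (antiprismSub.edgeChromaticNumber_coe_le_four_of_not_adj hn H v w hvw hH').trans_lt h5
end
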